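/- Let φ = p/q be a rational inner function on the polydisc 𝔻ⁿ (p, q ∈ ℂ[z₁,…,zₙ] with no common nonconstant factor, q zero-free on 𝔻ⁿ), let α ∈ 𝕋, and let μ_α be a Clark measure of φ at α, i.e., a finite positive Borel measure on 𝕋ⁿ such that ∫_{𝕋ⁿ} ∏_{j=1}^n (1−|z_j|²)/|ζ_j − z_j|² dμ_α(ζ) = (1−|φ(z)|²)/|α−φ(z)|² for every z ∈ 𝔻ⁿ. Set V_α := {ζ ∈ 𝕋ⁿ : p(ζ) = α·q(ζ)} and, at points ζ with q(ζ) ≠ 0, let ∇φ(ζ) := (q(ζ)·∇p(ζ) − p(ζ)·∇q(ζ))/q(ζ)², where ∇ denotes the vector of complex partial derivatives. Then for every Borel set A ⊆ 𝕋ⁿ one has μ_α(A) = (2π)^{1−n} ∫_{A ∩ V_α} |∇φ(ζ)|^{−1} dℋ^{n−1}(ζ), where ℋ^{n−1} is the (n−1)-dimensional Hausdorff measure normalized so that (n−1)-dimensional unit cubes have measure 1 (the integrand is defined ℋ^{n−1}-almost everywhere on V_α since ℋ^{n−1}({q = 0} ∩ 𝕋ⁿ) = 0, and ∇φ ≠ 0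 ℋ^{n−1}-a.e. on V_α). The same identity holds with φ₁⁻¹(α) := {ζ ∈ 𝕋ⁿ : lim_{ρ→1⁻} φ(ρζ) = α} in place of V_α. -/

import Mathlib

open MeasureTheory Filter Set
open scoped ENNReal

noncomputable section

/-- We endow finite-dimensional complex Euclidean spaces with their Borel σ-algebra. -/
instance {ι : Type*} [Fintype ι] : MeasurableSpace (EuclideanSpace ℂ ι) := borel _
instance {ι : Type*} [Fintype ι] : BorelSpace (EuclideanSpace ℂ ι) := ⟨rfl⟩

/-- Evaluation of a polynomial in the variables `ι` at a point of `ℂ^ι`. -/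
def pEval {ι : Type*} (p : MvPolynomial ι ℂ) (z : EuclideanSpace ℂ ι) : ℂ :=
  MvPolynomial.eval (fun i => z i) p

/-- The open unit polydisc `𝔻ⁿ` in `ℂⁿ`. -/
def polydisc (n : ℕ) : Set (EuclideanSpace ℂ (Fin n)) := {z | ∀ j, ‖z j‖ < 1}

/-- The unit torus `𝕋^ι` in `ℂ^ι`. -/
def torus (ι : Type*) : Set (EuclideanSpace ℂ ι) := {ζ | ∀ j, ‖ζ j‖ = 1}

/-- `φ` has radial limit `α` at `ζ`: `φ(ρζ) → α` as `ρ → 1⁻`. -/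
def HasRadialLimit {n : ℕ} (φ : EuclideanSpace ℂ (Fin n) → ℂ)
    (ζ : EuclideanSpace ℂ (Fin n)) (α : ℂ) : Prop :=
  Tendsto (fun ρ : ℝ => φ ((ρ : ℂ) • ζ)) (nhdsWithin 1 (Set.Iio 1)) (nhds α)

/-- `φ` is the rational inner function `p/q` on the polydisc `𝔻ⁿ`: `p, q` have no common
nonconstant factor, `q` is zero-free on `𝔻ⁿ`, `|φ| < 1` on `𝔻ⁿ`, and for a.e. `ζ ∈ 𝕋ⁿ`
(w.r.t. the Haar measure of `𝕋ⁿ`, i.e. up to an `ℋⁿ`-null set) the radial limit of `φ` at `ζ`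
exists and is unimodular. -/
structure IsRationalInner (n : ℕ) (p q : MvPolynomial (Fin n) ℂ)
    (φ : EuclideanSpace ℂ (Fin n) → ℂ) : Prop where
  coprime : ∀ d : MvPolynomial (Fin n) ℂ, d ∣ p → d ∣ q → IsUnit d
  q_ne_zero : ∀ z ∈ polydisc n, pEval q z ≠ 0
  phi_eq : ∀ z ∈ polydisc n, φ z = pEval p z / pEval q z
  abs_lt_one : ∀ z ∈ polydisc n, ‖φ z‖ < 1
  inner : ∃ E ⊆ torus (Fin n), μH[(n : ℝ)] E = 0 ∧
    ∀ ζ ∈ torus (Fin n) \ E, ∃ β : ℂ, ‖β‖ = 1 ∧ HasRadialLimit φ ζ β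

/-- `μ` is a Clark measure of `φ` at `α`: a finite positive Borel measure on `𝕋ⁿ` whose
Poisson–Szegő integral is `(1-|φ|²)/|α-φ|²`. -/
def IsClarkMeasure (n : ℕ) (φ : EuclideanSpace ℂ (Fin n) → ℂ) (α : ℂ)
    (μ : Measure (EuclideanSpace ℂ (Fin n))) : Prop :=
  IsFiniteMeasure μ ∧ μ (torus (Fin n))ᶜ = 0 ∧
    ∀ z ∈ polydisc n,
      ∫⁻ ζ, ENNReal.ofReal (∏ j, (1 - ‖z j‖ ^ 2) / ‖ζ j - z j‖ ^ 2) ∂μ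
        = ENNReal.ofReal ((1 - ‖φ z‖ ^ 2) / ‖α - φ z‖ ^ 2)

/-- The subset of `L²(μ)` consisting of (classes of) holomorphic polynomial functions;
`H²(μ)` is its closure in `L²(μ)`. -/
def polyLp (n : ℕ) (μ : Measure (EuclideanSpace ℂ (Fin n))) : Set (Lp ℂ 2 μ) :=
  {f | ∃ p : MvPolynomial (Fin n) ℂ, ⇑f =ᵐ[μ] pEval p}

/-- `φ₁⁻¹(α)`: the set of `ζ ∈ 𝕋ⁿ` where the radial limit of `φ` exists and equals `α`. -/
def radialFiber {n : ℕ} (φ : EuclideanSpace ℂ (Fin n) → ℂ) (α : ℂ) :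
    Set (EuclideanSpace ℂ (Fin n)) :=
  {ζ | ζ ∈ torus (Fin n) ∧ HasRadialLimit φ ζ α}

/-- The common zero set in `ℂ^ι` of a finite family of real polynomials in the real and
imaginary parts of the coordinates. -/
def realZeroSet {ι : Type*} (s : Finset (MvPolynomial (ι × Bool) ℝ)) :
    Set (EuclideanSpace ℂ ι) :=
  {w | ∀ P ∈ s, MvPolynomial.eval (fun ib => if ib.2 then (w ib.1).re else (w ib.1).im) P = 0}

/-- The projection `ℂⁿ → ℂ^{n-1}` deleting the `j`-th coordinate. -/
def deleteCoord {n : ℕ} (j : Fin n) (ζ : EuclideanSpace ℂ (Fin n)) :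
    EuclideanSpace ℂ {i : Fin n // i ≠ j} :=
  (WithLp.equiv 2 _).symm fun i => ζ i.1

/-- The `μH[k]`-measure of a `k`-dimensional unit cube (computed in `ℝᵏ`); dividing `μH[k]`
by this constant yields the Hausdorff measure normalized so that `k`-dimensional unit cubes
have measure `1`. -/
def cubeMeasure (k : ℕ) : ℝ≥0∞ :=
  μH[(k : ℝ)] {x : EuclideanSpace ℝ (Fin k) | ∀ i, x i ∈ Set.Icc (0 : ℝ) 1}

/-- The Euclidean norm `|∇φ(ζ)|` of the gradient of `φ = p/q`, where
`∇φ = (q ∇p − p ∇q)/q²`. -/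
def gradNorm {n : ℕ} (p q : MvPolynomial (Fin n) ℂ) (ζ : EuclideanSpace ℂ (Fin n)) : ℝ :=
  Real.sqrt (∑ i, ‖
    (pEval q ζ * pEval (MvPolynomial.pderiv i p) ζ -
      pEval p ζ * pEval (MvPolynomial.pderiv i q) ζ) / (pEval q ζ) ^ 2‖ ^ 2)

open Polynomial in
theorem IsRelPrime.isCoprime_map_fractionRing {R K : Type*} [CommRing R] [IsDomain R]
    [NormalizedGCDMonoid R] [Field K] [Algebra R K] [IsFractionRing R K]
    {f g : R[X]} (hf : f ≠ 0) (h : IsRelPrime f g) :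
    IsCoprime (f.map (algebraMap R K)) (g.map (algebraMap R K)) := by
  have hinj := IsFractionRing.injective R K
  refine isCoprime_of_irreducible_dvd
    (fun H => hf ((Polynomial.map_eq_zero_iff hinj).1 H.1)) fun z hz hzf hzg => ?_
  set z₀ := IsLocalization.integerNormalization (nonZeroDivisors R) z with hz₀
  obtain ⟨b, hbM, hb⟩ := IsLocalization.integerNormalization_spec (nonZeroDivisors R) z
  have hb0 : algebraMap R K b ≠ 0 := IsFractionRing.to_map_ne_zero_of_mem_nonZeroDivisors hbM
  have hdvd : (z₀.primPart).map (algebraMap R K) ∣ z := by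
    have h1 : (z₀.primPart).map (algebraMap R K) ∣ z₀.map (algebraMap R K) :=
      Polynomial.map_dvd _ z₀.primPart_dvd
    rw [hz₀, hb, ← hz₀, Algebra.smul_def, Polynomial.algebraMap_apply] at h1
    have hu : IsUnit (Polynomial.C (algebraMap R K b)) := Polynomial.isUnit_C.2 hb0.isUnit
    exact (hu.dvd_mul_left).1 h1
  have hprim := z₀.isPrimitive_primPart
  have h1 : z₀.primPart ∣ f := hprim.dvd_of_fraction_map_dvd_fraction_map (hdvd.trans hzf)
  have h2 : z₀.primPart ∣ g := hprim.dvd_of_fraction_map_dvd_fraction_map (hdvd.trans hzg)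
  exact hz.not_isUnit (Polynomial.isUnit_or_eq_zero_of_isUnit_integerNormalization_primPart
    hz.ne_zero (h h1 h2))

open Polynomial in
/-- In a unique factorization domain, relatively prime polynomials generate a nonzero constant. -/
theorem IsRelPrime.exists_mul_add_mul_eq_C {R : Type*} [CommRing R] [IsDomain R]
    [UniqueFactorizationMonoid R] {f g : R[X]} (hf : f ≠ 0) (h : IsRelPrime f g) :
    ∃ (a b : R[X]) (r : R), r ≠ 0 ∧ a * f + b * g = C r := by
  classical
  let _ : StrongNormalizationMonoid R := UniqueFactorizationMonoid.strongNormalizationMonoid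
  let _ : NormalizedGCDMonoid R := UniqueFactorizationMonoid.toNormalizedGCDMonoid R
  obtain ⟨a, b, hab⟩ := h.isCoprime_map_fractionRing (K := FractionRing R) hf
  obtain ⟨r, hr, hra⟩ := IsLocalization.integerNormalization_spec (nonZeroDivisors R) a
  obtain ⟨s, hs, hsb⟩ := IsLocalization.integerNormalization_spec (nonZeroDivisors R) b
  refine ⟨C s * IsLocalization.integerNormalization (nonZeroDivisors R) a,
    C r * IsLocalization.integerNormalization (nonZeroDivisors R) b, r * s,
    mul_ne_zero (nonZeroDivisors.ne_zero hr) (nonZeroDivisors.ne_zero hs), ?_⟩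
  apply Polynomial.map_injective _ (IsFractionRing.injective R (FractionRing R))
  simp only [Polynomial.map_add, Polynomial.map_mul, Polynomial.map_C, hra, hsb, Algebra.smul_def,
    Polynomial.algebraMap_apply, map_mul]
  linear_combination (C (algebraMap R (FractionRing R) r) *
    C (algebraMap R (FractionRing R) s)) * hab

/-- The substitution `p(z) ↦ p(λz)`, with `λ` a new variable. -/
def scaleVar (σ : Type*) :
    MvPolynomial σ ℂ →ₐ[ℂ] Polynomial (MvPolynomial σ ℂ) :=
  MvPolynomial.aeval fun i => Polynomial.X * Polynomial.C (MvPolynomial.X i)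

theorem eval_eval_scaleVar {σ : Type*} (p : MvPolynomial σ ℂ) (z : σ → ℂ) (t : ℂ) :
    MvPolynomial.eval z ((scaleVar σ p).eval (MvPolynomial.C t)) =
      MvPolynomial.eval (fun i => t * z i) p := by
  induction p using MvPolynomial.induction_on with
  | C a =>
    simp [scaleVar, MvPolynomial.algebraMap_eq, Polynomial.algebraMap_apply]
  | add p q hp hq => simp [hp, hq]
  | mul_X p i hp => simp [hp]; simp [scaleVar]; simp [mul_comm]

theorem isUnit_of_dvd_scaleVar {σ : Type*} {p q : MvPolynomial σ ℂ}
    (hpq : ∀ d : MvPolynomial σ ℂ, d ∣ p → d ∣ q → IsUnit d) (hq : MvPolynomial.eval 0 q ≠ 0)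
    {d : Polynomial (MvPolynomial σ ℂ)} (hp' : d ∣ scaleVar σ p) (hq' : d ∣ scaleVar σ q) :
    IsUnit d := by
  -- `d(t, ·)` is a constant for every `t ≠ 0`
  have hconst : ∀ t : ℂ, t ≠ 0 → ∃ c, d.eval (MvPolynomial.C t) = MvPolynomial.C c := by
    intro t ht
    let sc : MvPolynomial σ ℂ →ₐ[ℂ] MvPolynomial σ ℂ :=
      MvPolynomial.aeval fun i => MvPolynomial.C t⁻¹ * MvPolynomial.X i
    have hev : ∀ f z, MvPolynomial.eval z (sc f) = MvPolynomial.eval (fun i => t⁻¹ * z i) f := by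
      intro f z
      induction f using MvPolynomial.induction_on with
      | C a => simp [sc, MvPolynomial.algebraMap_eq]
      | add p q hp hq => simp [hp, hq]
      | mul_X p i hp => simp [hp]; simp [sc]
    have hback : ∀ f, sc ((scaleVar σ f).eval (MvPolynomial.C t)) = f := by
      intro f
      apply MvPolynomial.funext_iff.2
      intro z
      rw [hev, eval_eval_scaleVar]
      simp only [mul_inv_cancel_left₀ ht]
    have hdv : ∀ f, d ∣ scaleVar σ f → sc (d.eval (MvPolynomial.C t)) ∣ f := by
      intro f hf
      have := map_dvd sc (map_dvd (Polynomial.evalRingHom (MvPolynomial.C t)) hf)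
      simpa [hback] using this
    obtain ⟨r, -, hr⟩ := MvPolynomial.isUnit_iff_eq_C_of_isReduced.1 (hpq _ (hdv p hp') (hdv q hq'))
    refine ⟨r, ?_⟩
    apply MvPolynomial.funext_iff.2
    intro z
    have := congrArg (MvPolynomial.eval fun i => t * z i) hr
    rw [hev] at this
    simpa [ht] using this
  -- `d(·, 0)` is a nonzero constant
  obtain ⟨c, hc0, hc⟩ : ∃ c : ℂ, c ≠ 0 ∧ d.map (MvPolynomial.eval 0) = Polynomial.C c := by
    have h1 : d.map (MvPolynomial.eval (0 : σ → ℂ)) ∣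
        (scaleVar σ q).map (MvPolynomial.eval 0) := Polynomial.map_dvd _ hq'
    have h2 : (scaleVar σ q).map (MvPolynomial.eval 0) =
        Polynomial.C (MvPolynomial.eval 0 q) := by
      apply Polynomial.funext
      intro t
      have := eval_eval_scaleVar q 0 t
      rw [← Polynomial.eval_map_apply] at this
      simpa [← Pi.zero_def] using this
    rw [h2] at h1
    obtain ⟨c, hcu, hc⟩ :=
      Polynomial.isUnit_iff.1 (isUnit_of_dvd_unit h1 (Polynomial.isUnit_C.2 hq.isUnit))
    exact ⟨c, hcu.ne_zero, hc.symm⟩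
  have hd : d = Polynomial.C (MvPolynomial.C c) := by
    rw [← sub_eq_zero]
    apply Polynomial.eq_zero_of_infinite_isRoot
    refine Set.Infinite.mono (s := MvPolynomial.C '' {t : ℂ | t ≠ 0}) ?_ ?_
    · rintro _ ⟨t, ht, rfl⟩
      obtain ⟨c', hc'⟩ := hconst t ht
      have h3 := congrArg (Polynomial.eval t) hc
      have h4 := congrArg (MvPolynomial.eval (0 : σ → ℂ)) hc'
      rw [← Polynomial.eval_map_apply] at h4
      simp only [MvPolynomial.eval_C, Polynomial.eval_C] at h3 h4
      rw [h3] at h4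
      simp [Polynomial.IsRoot, hc', h4]
    · exact (Set.finite_singleton (0 : ℂ)).infinite_compl.image
        (MvPolynomial.C_injective σ ℂ).injOn
  rw [hd]
  exact Polynomial.isUnit_C.2 ((isUnit_iff_ne_zero.2 hc0).map MvPolynomial.C)

/-- A resultant: the lines through the origin meeting `{p = q = 0}` satisfy a nontrivial
polynomial equation. -/
theorem exists_ne_zero_eval_eq_zero_of_common_zero {σ : Type*}
    {p q : MvPolynomial σ ℂ} (hpq : ∀ d : MvPolynomial σ ℂ, d ∣ p → d ∣ q → IsUnit d)
    (hq : MvPolynomial.eval 0 q ≠ 0) :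
    ∃ r : MvPolynomial σ ℂ, r ≠ 0 ∧ ∀ (z : σ → ℂ) (t : ℂ),
      MvPolynomial.eval (fun i => t * z i) p = 0 → MvPolynomial.eval (fun i => t * z i) q = 0 →
        MvPolynomial.eval z r = 0 := by
  have hq0 : scaleVar σ q ≠ 0 := by
    intro h
    have := eval_eval_scaleVar q 0 0
    simp only [h, Polynomial.eval_zero, map_zero, Pi.zero_apply, mul_zero] at this
    exact hq this.symm
  have hrel : IsRelPrime (scaleVar σ q) (scaleVar σ p) := fun d hd hd' =>
    isUnit_of_dvd_scaleVar hpq hq hd' hd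
  obtain ⟨a, b, r, hr, h⟩ := hrel.exists_mul_add_mul_eq_C hq0
  refine ⟨r, hr, fun z t h1 h2 => ?_⟩
  have := congrArg (fun f => MvPolynomial.eval z (f.eval (MvPolynomial.C t))) h
  simpa [eval_eval_scaleVar, h1, h2] using this.symm

/-- The parametrization `x ↦ (exp (2πi x_j))_j` of the torus. -/
def torusExp {ι : Type*} (x : ι → UnitAddCircle) : EuclideanSpace ℂ ι :=
  WithLp.toLp 2 fun i => (AddCircle.toCircle (x i) : ℂ)

@[simp]
theorem torusExp_apply {ι : Type*} (x : ι → UnitAddCircle) (i : ι) :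
    torusExp x i = (AddCircle.toCircle (x i) : ℂ) := rfl

theorem continuous_torusExp {ι : Type*} : Continuous (torusExp (ι := ι)) := by
  unfold torusExp
  refine (PiLp.continuous_toLp 2 _).comp (continuous_pi fun i => ?_)
  exact continuous_subtype_val.comp (AddCircle.continuous_toCircle.comp (continuous_apply i))

theorem torusExp_injective {ι : Type*} : Function.Injective (torusExp (ι := ι)) := by
  intro x y h
  ext i
  have := congrFun (congrArg WithLp.ofLp h) i
  exact AddCircle.injective_toCircle one_ne_zero (Subtype.ext this)

theorem range_torusExp {ι : Type*} : range (torusExp (ι := ι)) = torus ι := by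
  ext z
  constructor
  · rintro ⟨x, rfl⟩ j
    exact Circle.norm_coe _
  · intro hz
    have hs : ∀ i, ∃ x : UnitAddCircle, (AddCircle.toCircle x : ℂ) = z i := by
      intro i
      obtain ⟨x, hx⟩ := (AddCircle.homeomorphCircle (T := 1) one_ne_zero).surjective
        ⟨z i, mem_sphere_zero_iff_norm.2 (hz i)⟩
      refine ⟨x, ?_⟩
      rw [AddCircle.homeomorphCircle_apply] at hx
      rw [hx]
    choose x hx using hs
    refine ⟨x, ?_⟩
    ext i
    simp [hx]

theorem measurableEmbedding_torusExp {ι : Type*} [Fintype ι] :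
    MeasurableEmbedding (torusExp (ι := ι)) :=
  (continuous_torusExp.isClosedEmbedding torusExp_injective).measurableEmbedding

/-- The orbit `l ↦ (l, l + w₁, …, l + w_k)` of the diagonal action. -/
def diagOrbit {k : ℕ} (w : Fin k → UnitAddCircle) (l : UnitAddCircle) :
    Fin (k + 1) → UnitAddCircle := Fin.cons l fun j => l + w j

theorem measurePreserving_diagOrbit (k : ℕ) :
    MeasurePreserving (fun x : UnitAddCircle × (Fin k → UnitAddCircle) => diagOrbit x.2 x.1)
      (volume.prod volume) volume := by
  have h1 : MeasurePreserving (fun x : UnitAddCircle × (Fin k → UnitAddCircle) =>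
      (x.1, (fun _ => x.1) + x.2)) (volume.prod volume) (volume.prod volume) := by
    refine (MeasurePreserving.id volume).skew_product (g := fun l w => (fun _ => l) + w)
      (by fun_prop) ?_
    exact Eventually.of_forall fun l => (measurePreserving_add_left volume _).map_eq
  have h2 := ((volume_preserving_piFinSuccAbove
    (fun _ : Fin (k + 1) => UnitAddCircle) 0).symm).comp h1
  have h3 : (fun x : UnitAddCircle × (Fin k → UnitAddCircle) => diagOrbit x.2 x.1) =
      (MeasurableEquiv.piFinSuccAbove (fun _ : Fin (k + 1) => UnitAddCircle) 0).symm ∘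
        fun x => (x.1, (fun _ => x.1) + x.2) := by
    ext x i
    refine Fin.cases ?_ (fun j => ?_) i <;>
      simp [diagOrbit, MeasurableEquiv.piFinSuccAbove, Fin.insertNthEquiv]
  rw [h3]
  exact h2

instance : NullSingletonClass (volume : Measure UnitAddCircle) where
  measure_singleton x := by
    refine le_antisymm (ENNReal.le_of_forall_pos_le_add fun ε hε _ => ?_) bot_le
    calc volume {x} ≤ volume (Metric.closedBall x ((ε : ℝ) / 2)) :=
          measure_mono (singleton_subset_iff.2 (Metric.mem_closedBall_self (by positivity)))
      _ ≤ 0 + ε := by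
          rw [AddCircle.volume_closedBall, zero_add, mul_div_cancel₀ _ two_ne_zero]
          refine (ENNReal.ofReal_le_ofReal (min_le_right _ _)).trans_eq ?_
          exact ENNReal.ofReal_coe_nnreal

theorem ae_eval_torusExp_ne_zero {n : ℕ} {r : MvPolynomial (Fin n) ℂ} (hr : r ≠ 0) :
    ∀ᵐ x : Fin n → UnitAddCircle, pEval r (torusExp x) ≠ 0 := by
  induction n with
  | zero =>
    refine Eventually.of_forall fun x => ?_
    obtain ⟨c, rfl⟩ := MvPolynomial.C_surjective (Fin 0) r
    simpa [pEval] using hr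
  | succ n ih =>
    have hcont : Continuous fun x : Fin (n + 1) → UnitAddCircle => pEval r (torusExp x) := by
      unfold pEval
      refine (MvPolynomial.continuous_eval r).comp (continuous_pi fun i => ?_)
      exact (PiLp.continuous_apply 2 _ i).comp continuous_torusExp
    have hmp := (volume_preserving_piFinSuccAbove (fun _ : Fin (n + 1) => UnitAddCircle) 0).symm
    have hmeas : MeasurableSet {x : Fin (n + 1) → UnitAddCircle | pEval r (torusExp x) ≠ 0} :=
      (isOpen_ne_fun hcont continuous_const).measurableSet
    rw [← hmp.map_eq, ae_map_iff hmp.measurable.aemeasurable hmeas, Measure.volume_eq_prod]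
    set f := MvPolynomial.finSuccEquiv ℂ n r with hf
    have hf0 : f ≠ 0 := by simpa [hf] using hr
    have hlead := ih (Polynomial.leadingCoeff_ne_zero.2 hf0)
    have hms := hmp.measurable hmeas
    refine (Measure.ae_prod_iff_ae_ae hms).2 ?_
    refine (Measure.ae_ae_comm (p := fun l w => pEval r (torusExp
      ((MeasurableEquiv.piFinSuccAbove (fun _ : Fin (n + 1) => UnitAddCircle) 0).symm (l, w))) ≠ 0)
      hms).2 ?_
    filter_upwards [hlead] with w hw
    set g := Polynomial.map (MvPolynomial.eval fun i => torusExp w i) f with hg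
    have hg0 : g ≠ 0 := by
      intro h
      apply hw
      have := congrArg (fun P => Polynomial.coeff P f.natDegree) h
      simpa [hg, Polynomial.coeff_map, pEval] using this
    have hfin : {l : UnitAddCircle | g.eval (AddCircle.toCircle l : ℂ) = 0}.Finite := by
      refine Set.Finite.preimage (f := fun l : UnitAddCircle => (AddCircle.toCircle l : ℂ))
        (fun a _ b _ h => AddCircle.injective_toCircle one_ne_zero (Subtype.ext h)) ?_
        (s := {z | g.eval z = 0})
      exact (Polynomial.rootSet_finite g ℂ).subset fun z hz => by
        simpa [Polynomial.mem_rootSet, hg0] using hz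
    have hnull : ∀ᵐ l : UnitAddCircle, l ∉ {l : UnitAddCircle |
        g.eval (AddCircle.toCircle l : ℂ) = 0} :=
      measure_eq_zero_iff_ae_notMem.1 (hfin.measure_zero _)
    filter_upwards [hnull] with l hl
    have key := MvPolynomial.eval_eq_eval_mv_eval' (fun i => torusExp w i)
      (AddCircle.toCircle l : ℂ) r
    rw [← hf, ← hg] at key
    have e : (fun i => torusExp ((MeasurableEquiv.piFinSuccAbove
        (fun _ : Fin (n + 1) => UnitAddCircle) 0).symm (l, w)) i) =
        Fin.cons (AddCircle.toCircle l : ℂ) (fun i => torusExp w i) := by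
      funext i
      refine Fin.cases ?_ (fun j => ?_) i <;>
        simp [MeasurableEquiv.piFinSuccAbove, Fin.insertNthEquiv]
    show MvPolynomial.eval _ r ≠ 0
    rw [e, key]
    exact hl

theorem continuous_pEval {ι : Type*} (p : MvPolynomial ι ℂ) : Continuous (pEval p) := by
  unfold pEval
  exact (MvPolynomial.continuous_eval p).comp
    (continuous_pi fun i => (PiLp.continuous_apply 2 _ i))

theorem smul_mem_polydisc {n : ℕ} {ζ : EuclideanSpace ℂ (Fin n)} (hζ : ζ ∈ torus (Fin n))
    {z : ℂ} (hz : ‖z‖ < 1) : z • ζ ∈ polydisc n := fun j => by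
  simpa [hζ j] using hz

/-- Relatively open subsets of the torus have positive Hausdorff measure. -/
theorem hausdorffMeasure_inter_torus_pos {n : ℕ} {ζ : EuclideanSpace ℂ (Fin n)}
    (hζ : ζ ∈ torus (Fin n)) {U : Set (EuclideanSpace ℂ (Fin n))} (hU : U ∈ nhds ζ) :
    0 < μH[(n : ℝ)] (U ∩ torus (Fin n)) := by
  set f : EuclideanSpace ℂ (Fin n) → Fin n → ℝ := fun z j => (starRingEnd ℂ (ζ j) * z j).im
  set g : (Fin n → ℝ) → EuclideanSpace ℂ (Fin n) := fun s =>
    WithLp.toLp 2 fun j => ζ j * ((Real.sqrt (1 - s j ^ 2) : ℂ) + s j * Complex.I) with hg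
  have hf : LipschitzWith 1 f := by
    refine LipschitzWith.of_dist_le_mul fun x y => ?_
    rw [NNReal.coe_one, one_mul]
    refine (dist_pi_le_iff dist_nonneg).2 fun j => ?_
    rw [dist_eq_norm, dist_eq_norm]
    simp only [f]
    rw [← Complex.sub_im, ← mul_sub]
    refine (Complex.abs_im_le_norm _).trans ?_
    rw [norm_mul, Complex.norm_conj, hζ j, one_mul]
    exact PiLp.norm_apply_le (x - y) j
  have hgc : Continuous g := by
    refine (PiLp.continuous_toLp 2 _).comp (continuous_pi fun j => ?_)
    fun_prop
  have hg0 : g 0 = ζ := by ext j; simp [g]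
  have hV : g ⁻¹' U ∩ {s | ∀ j, |s j| < 1} ∈ nhds (0 : Fin n → ℝ) := by
    refine inter_mem (hgc.continuousAt.preimage_mem_nhds (by rwa [hg0])) ?_
    filter_upwards [Metric.ball_mem_nhds (0 : Fin n → ℝ) one_pos] with s hs j
    rw [mem_ball_zero_iff] at hs
    exact (norm_le_pi_norm s j).trans_lt hs
  have hsub : g ⁻¹' U ∩ {s | ∀ j, |s j| < 1} ⊆ f '' (U ∩ torus (Fin n)) := by
    rintro s ⟨hsU, hs⟩
    have h1 : ∀ j, 0 ≤ 1 - s j ^ 2 := fun j => by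
      have := hs j
      rw [abs_lt] at this
      nlinarith
    refine ⟨g s, ⟨hsU, fun j => ?_⟩, ?_⟩
    · simp only [g, norm_mul, hζ j, one_mul]
      rw [Complex.norm_add_mul_I, Real.sq_sqrt (h1 j)]
      simp
    · funext j
      simp only [f, g]
      rw [← mul_assoc, ← Complex.normSq_eq_conj_mul_self, Complex.normSq_eq_norm_sq, hζ j]
      simp
  have hpos : 0 < μH[(n : ℝ)] (f '' (U ∩ torus (Fin n))) := by
    have e := hausdorffMeasure_pi_real (ι := Fin n)
    rw [Fintype.card_fin] at e
    rw [e]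
    exact (Measure.measure_pos_of_mem_nhds volume hV).trans_le (measure_mono hsub)
  refine hpos.trans_le ?_
  simpa using hf.hausdorffMeasure_image_le (Nat.cast_nonneg n) (U ∩ torus (Fin n))

namespace IsRationalInner

variable {n : ℕ} {p q : MvPolynomial (Fin n) ℂ} {φ : EuclideanSpace ℂ (Fin n) → ℂ}

theorem tendsto_smul (ζ : EuclideanSpace ℂ (Fin n)) :
    Tendsto (fun ρ : ℝ => (ρ : ℂ) • ζ) (nhdsWithin 1 (Iio 1)) (nhds ζ) := by
  have : Continuous fun ρ : ℝ => (ρ : ℂ) • ζ := by fun_prop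
  simpa using (this.tendsto 1).mono_left nhdsWithin_le_nhds

theorem eventually_smul_mem {ζ : EuclideanSpace ℂ (Fin n)} (hζ : ζ ∈ torus (Fin n)) :
    ∀ᶠ ρ : ℝ in nhdsWithin 1 (Iio 1), (ρ : ℂ) • ζ ∈ polydisc n := by
  filter_upwards [Ioo_mem_nhdsLT (show (0 : ℝ) < 1 by norm_num)] with ρ hρ
  refine smul_mem_polydisc hζ ?_
  rw [Complex.norm_real, Real.norm_eq_abs, abs_of_pos hρ.1]
  exact hρ.2

theorem norm_eval_eq (h : IsRationalInner n p q φ) {ζ : EuclideanSpace ℂ (Fin n)}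
    (hζ : ζ ∈ torus (Fin n)) : ‖pEval p ζ‖ = ‖pEval q ζ‖ := by
  obtain ⟨E, hE, hE0, hlim⟩ := h.inner
  have key : ∀ ζ ∈ torus (Fin n) \ E, ‖pEval p ζ‖ = ‖pEval q ζ‖ := by
    intro ζ hζ
    obtain ⟨β, hβ, hl⟩ := hlim ζ hζ
    have h1 := ((continuous_pEval p).norm.tendsto ζ).comp (tendsto_smul ζ)
    have h2 := hl.norm.mul (((continuous_pEval q).norm.tendsto ζ).comp (tendsto_smul ζ))
    rw [hβ, one_mul] at h2
    refine tendsto_nhds_unique h1 (h2.congr' ?_)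
    filter_upwards [eventually_smul_mem hζ.1] with ρ hρ
    simp only [Function.comp]
    rw [h.phi_eq _ hρ, norm_div, div_mul_cancel₀ _ (norm_ne_zero_iff.2 (h.q_ne_zero _ hρ))]
  by_contra hne
  have hopen : {z | ‖pEval p z‖ ≠ ‖pEval q z‖} ∈ nhds ζ :=
    (isOpen_ne_fun (continuous_pEval p).norm (continuous_pEval q).norm).mem_nhds hne
  have := hausdorffMeasure_inter_torus_pos hζ hopen
  refine this.ne' (measure_mono_null (fun z hz => ?_) hE0)
  by_contra hzE
  exact hz.1 (key z ⟨hz.2, hzE⟩)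

theorem hasRadialLimit (h : IsRationalInner n p q φ) {ζ : EuclideanSpace ℂ (Fin n)}
    (hζ : ζ ∈ torus (Fin n)) (hq : pEval q ζ ≠ 0) :
    HasRadialLimit φ ζ (pEval p ζ / pEval q ζ) := by
  have h1 := ((((continuous_pEval p).tendsto ζ).div ((continuous_pEval q).tendsto ζ) hq).comp
    (tendsto_smul ζ))
  refine h1.congr' ?_
  filter_upwards [eventually_smul_mem hζ] with ρ hρ
  exact (h.phi_eq _ hρ).symm

theorem mem_radialFiber_iff (h : IsRationalInner n p q φ) {α : ℂ}
    {ζ : EuclideanSpace ℂ (Fin n)} (hζ : ζ ∈ torus (Fin n)) (hq : pEval q ζ ≠ 0) :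
    ζ ∈ radialFiber φ α ↔ pEval p ζ = α * pEval q ζ := by
  rw [← div_eq_iff hq]
  constructor
  · rintro ⟨-, hl⟩
    exact tendsto_nhds_unique (h.hasRadialLimit hζ hq) hl
  · rintro rfl
    exact ⟨hζ, h.hasRadialLimit hζ hq⟩

theorem dim_ne_zero (h : IsRationalInner n p q φ) : n ≠ 0 := by
  rintro rfl
  have h0 : (0 : EuclideanSpace ℂ (Fin 0)) ∈ polydisc 0 := fun j => j.elim0
  have h1 := h.abs_lt_one 0 h0
  rw [h.phi_eq 0 h0, norm_div, h.norm_eval_eq (fun j => j.elim0),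
    div_self (norm_ne_zero_iff.2 (h.q_ne_zero 0 h0))] at h1
  exact lt_irrefl _ h1

end IsRationalInner

/-- The quotient `P / Q` of two polynomials in one variable, of modulus less than `1` on the open
unit disc and of modulus `1` on the unit circle where it is defined. -/
structure IsInnerPair (P Q : Polynomial ℂ) : Prop where
  ne_zero : ∀ z : ℂ, ‖z‖ < 1 → Q.eval z ≠ 0
  norm_lt : ∀ z : ℂ, ‖z‖ < 1 → ‖P.eval z‖ < ‖Q.eval z‖
  norm_eq : ∀ z : ℂ, ‖z‖ = 1 → ‖P.eval z‖ = ‖Q.eval z‖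

/-- The derivative of `P / Q` at `z`. -/
def quotDeriv (P Q : Polynomial ℂ) (z : ℂ) : ℂ :=
  (Q.eval z * P.derivative.eval z - P.eval z * Q.derivative.eval z) / Q.eval z ^ 2

theorem hasDerivAt_quotDeriv (P Q : Polynomial ℂ) {z : ℂ} (hz : Q.eval z ≠ 0) :
    HasDerivAt (fun z => P.eval z / Q.eval z) (quotDeriv P Q z) z := by
  refine ((P.hasDerivAt z).div (Q.hasDerivAt z) hz).congr_deriv ?_
  unfold quotDeriv
  ring

theorem norm_one_sub_conj_mul_sq (a b : ℂ) :
    ‖1 - (starRingEnd ℂ) a * b‖ ^ 2 - ‖b - a‖ ^ 2 = (1 - ‖a‖ ^ 2) * (1 - ‖b‖ ^ 2) := by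
  simp only [← Complex.normSq_eq_norm_sq, Complex.normSq_apply, Complex.sub_re, Complex.sub_im,
    Complex.mul_re, Complex.mul_im, Complex.conj_re, Complex.conj_im, Complex.one_re,
    Complex.one_im]
  ring

/-- A quantitative form of the Schwarz-Pick lemma. -/
theorem one_sub_norm_sq_ge {f : ℂ → ℂ} (hf : DifferentiableOn ℂ f (Metric.ball 0 1))
    (hlt : ∀ z, ‖z‖ < 1 → ‖f z‖ < 1) {z : ℂ} (hz : ‖z‖ < 1) :
    (1 - ‖f 0‖) ^ 2 * (1 - ‖z‖ ^ 2) ≤ 1 - ‖f z‖ ^ 2 := by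
  set a := f 0 with ha
  have ha1 : ‖a‖ < 1 := hlt 0 (by simp)
  have hden : ∀ z, ‖z‖ < 1 → 1 - ‖a‖ ≤ ‖1 - (starRingEnd ℂ) a * f z‖ := by
    intro z hz
    have h1 : ‖(starRingEnd ℂ) a * f z‖ ≤ ‖a‖ := by
      rw [norm_mul, Complex.norm_conj]
      exact mul_le_of_le_one_right (norm_nonneg _) (hlt z hz).le
    have h2 := norm_sub_norm_le 1 ((starRingEnd ℂ) a * f z)
    rw [norm_one] at h2
    linarith
  have hden0 : ∀ z, ‖z‖ < 1 → 1 - (starRingEnd ℂ) a * f z ≠ 0 := fun z hz h => by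
    have := hden z hz
    rw [h, norm_zero] at this
    linarith
  set g : ℂ → ℂ := fun z => (f z - a) / (1 - (starRingEnd ℂ) a * f z) with hg
  have hgd : DifferentiableOn ℂ g (Metric.ball 0 1) :=
    (hf.sub_const a).div ((differentiableOn_const _).sub ((differentiableOn_const _).mul hf))
      fun z hz => hden0 z (mem_ball_zero_iff.1 hz)
  have hgm : MapsTo g (Metric.ball 0 1) (Metric.ball 0 1) := by
    intro z hz
    rw [mem_ball_zero_iff] at hz ⊢
    have h1 := norm_one_sub_conj_mul_sq a (f z)
    have h2 : 0 < (1 - ‖a‖ ^ 2) * (1 - ‖f z‖ ^ 2) := by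
      have := hlt z hz
      apply mul_pos <;> nlinarith [norm_nonneg a, norm_nonneg (f z)]
    rw [hg, norm_div, div_lt_one (norm_pos_iff.2 (hden0 z hz))]
    exact lt_of_pow_lt_pow_left₀ 2 (norm_nonneg _) (by linarith)
  have hle : ‖g z‖ ≤ ‖z‖ := by
    refine Complex.norm_le_norm_of_mapsTo_ball hgd ?_ (by simp [hg, ha]) hz
    exact hgm.mono_right Metric.ball_subset_closedBall
  rw [hg, norm_div, div_le_iff₀ (norm_pos_iff.2 (hden0 z hz))] at hle
  have h1 := norm_one_sub_conj_mul_sq a (f z)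
  have h2 : ‖f z - a‖ ^ 2 ≤ ‖z‖ ^ 2 * ‖1 - (starRingEnd ℂ) a * f z‖ ^ 2 := by
    rw [← mul_pow]
    gcongr
  have h3 : (1 - ‖a‖) ^ 2 ≤ ‖1 - (starRingEnd ℂ) a * f z‖ ^ 2 := by
    have := hden z hz
    gcongr
  have h4 : 0 ≤ 1 - ‖z‖ ^ 2 := by nlinarith [norm_nonneg z]
  have h5 : 0 ≤ 1 - ‖f z‖ ^ 2 := by nlinarith [norm_nonneg (f z), hlt z hz]
  have h6 := mul_le_mul_of_nonneg_right h3 h4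
  nlinarith [mul_nonneg (sq_nonneg ‖a‖) h5]

theorem hasDerivAt_norm_sq_comp {f : ℝ → ℂ} {f' : ℂ} {x : ℝ} (hf : HasDerivAt f f' x) :
    HasDerivAt (fun x => ‖f x‖ ^ 2) (2 * ((starRingEnd ℂ) (f x) * f').re) x := by
  convert hf.norm_sq using 1
  simp [Complex.inner, mul_comm]

namespace IsInnerPair

variable {P Q : Polynomial ℂ}

theorem hopf (h : IsInnerPair P Q) {l : ℂ} (hl : ‖l‖ = 1) (hQ : Q.eval l ≠ 0) :
    0 < ‖quotDeriv P Q l‖ ∧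
      l * quotDeriv P Q l = ‖quotDeriv P Q l‖ * (P.eval l / Q.eval l) := by
  set b : ℂ → ℂ := fun z => P.eval z / Q.eval z with hb
  have hbd := hasDerivAt_quotDeriv P Q hQ
  have hbl : ‖b l‖ = 1 := by
    rw [hb, norm_div, h.norm_eq l hl, div_self (norm_ne_zero_iff.2 hQ)]
  set w := (starRingEnd ℂ) (b l) * (l * quotDeriv P Q l) with hw
  have him : w.im = 0 := by
    have h1 : HasDerivAt (fun θ : ℝ => l * Complex.exp (θ * Complex.I)) (l * Complex.I) 0 := by
      have h0 : HasDerivAt (fun θ : ℝ => (θ : ℂ) * Complex.I) Complex.I 0 := by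
        simpa using (Complex.ofRealCLM.hasDerivAt (x := 0)).mul_const Complex.I
      simpa using h0.cexp.const_mul l
    have e0 : l * Complex.exp (((0 : ℝ) : ℂ) * Complex.I) = l := by simp
    have h2 : HasDerivAt (fun θ : ℝ => b (l * Complex.exp (θ * Complex.I)))
        (quotDeriv P Q l * (l * Complex.I)) 0 :=
      HasDerivAt.comp (𝕜 := ℝ) (0 : ℝ) (h₂ := b) (by rw [e0]; exact hbd) h1
    have h3 := hasDerivAt_norm_sq_comp h2
    have h4 : (fun θ : ℝ => ‖b (l * Complex.exp (θ * Complex.I))‖ ^ 2) =ᶠ[nhds 0]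
        fun _ => 1 := by
      have hc : ContinuousAt (fun θ : ℝ => Q.eval (l * Complex.exp (θ * Complex.I))) 0 := by
        fun_prop
      filter_upwards [hc.eventually_ne (by rw [e0]; exact hQ)] with θ hθ
      have : ‖l * Complex.exp (θ * Complex.I)‖ = 1 := by
        rw [norm_mul, hl, Complex.norm_exp_ofReal_mul_I, one_mul]
      simp only [hb]
      rw [norm_div, h.norm_eq _ this, div_self (norm_ne_zero_iff.2 hθ), one_pow]
    have h5 := (h3.congr_of_eventuallyEq h4.symm).unique (hasDerivAt_const 0 (1 : ℝ))
    rw [e0] at h5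
    have : (starRingEnd ℂ) (b l) * (quotDeriv P Q l * (l * Complex.I)) = w * Complex.I := by
      rw [hw]; ring
    rw [this, Complex.mul_I_re] at h5
    linarith
  have hre : 0 < w.re := by
    have h1 : HasDerivAt (fun r : ℝ => (r : ℂ) * l) l 1 := by
      simpa using (Complex.ofRealCLM.hasDerivAt (x := 1)).mul_const l
    have e0 : ((1 : ℝ) : ℂ) * l = l := by simp
    have h2 : HasDerivAt (fun r : ℝ => b (r * l)) (quotDeriv P Q l * l) 1 :=
      HasDerivAt.comp (𝕜 := ℝ) (1 : ℝ) (h₂ := b) (by rw [e0]; exact hbd) h1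
    have h3 := hasDerivAt_norm_sq_comp h2
    rw [e0] at h3
    have hbd0 : DifferentiableOn ℂ b (Metric.ball 0 1) := by
      intro z hz
      exact (hasDerivAt_quotDeriv P Q
        (h.ne_zero z (mem_ball_zero_iff.1 hz))).differentiableAt.differentiableWithinAt
    have hblt : ∀ z, ‖z‖ < 1 → ‖b z‖ < 1 := fun z hz => by
      simp only [hb]
      rw [norm_div, div_lt_one (norm_pos_iff.2 (h.ne_zero z hz))]
      exact h.norm_lt z hz
    have hc : 0 < (1 - ‖b 0‖) ^ 2 := by
      have := hblt 0 (by simp)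
      have : 0 < 1 - ‖b 0‖ := by linarith
      positivity
    have h4 := (hasDerivAt_iff_tendsto_slope.1 h3).mono_left
      (nhdsWithin_mono 1 (fun x (hx : x ∈ Iio 1) => hx.ne))
    have h5 : (1 - ‖b 0‖) ^ 2 ≤ 2 * ((starRingEnd ℂ) (b l) * (quotDeriv P Q l * l)).re := by
      refine ge_of_tendsto h4 ?_
      filter_upwards [Ioo_mem_nhdsLT (show (0 : ℝ) < 1 by norm_num)] with r hr
      have hrn : ‖(r : ℂ) * l‖ = r := by
        rw [norm_mul, hl, mul_one, Complex.norm_real, Real.norm_eq_abs, abs_of_pos hr.1]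
      have h6 := one_sub_norm_sq_ge hbd0 hblt (z := r * l) (by rw [hrn]; exact hr.2)
      rw [hrn] at h6
      rw [slope_def_field, e0, hbl, ← neg_div_neg_eq, le_div_iff₀ (by linarith [hr.2])]
      nlinarith [hr.1, hr.2, mul_nonneg hc.le (mul_nonneg hr.1.le (sub_nonneg.2 hr.2.le))]
    rw [mul_comm (quotDeriv P Q l)] at h5
    linarith
  have hwre : w = (w.re : ℂ) := by
    apply Complex.ext <;> simp [him]
  have hwn : ‖w‖ = ‖quotDeriv P Q l‖ := by
    rw [hw, norm_mul, norm_mul, Complex.norm_conj, hbl, hl, one_mul, one_mul]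
  have hwr : w.re = ‖quotDeriv P Q l‖ := by
    rw [← hwn, hwre, Complex.norm_real, Real.norm_eq_abs, abs_of_pos (by simpa using hre)]
    simp
  refine ⟨hwr ▸ hre, ?_⟩
  have hbb : b l * (starRingEnd ℂ) (b l) = 1 := by
    rw [Complex.mul_conj, Complex.normSq_eq_norm_sq, hbl]; simp
  rw [← hwr, ← hwre, hw]
  change _ = _ * b l
  linear_combination (-(l * quotDeriv P Q l)) * hbb

end IsInnerPair

theorem re_add_div_sub (a b : ℂ) :
    ((a + b) / (a - b)).re = (‖a‖ ^ 2 - ‖b‖ ^ 2) / ‖a - b‖ ^ 2 := by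
  rw [Complex.div_re, ← add_div, Complex.normSq_eq_norm_sq]
  congr 1
  simp only [← Complex.normSq_eq_norm_sq, Complex.normSq_apply, Complex.sub_re, Complex.sub_im,
    Complex.add_re, Complex.add_im]
  ring

/-- A function that is continuous on the closed unit disc, holomorphic in the open disc, and has
vanishing real part on the unit circle, has vanishing real part. -/
theorem re_eq_zero_of_re_eq_zero_on_circle {f : ℂ → ℂ}
    (hf : DiffContOnCl ℂ f (Metric.ball 0 1)) (h0 : ∀ z, ‖z‖ = 1 → (f z).re = 0)
    {z : ℂ} (hz : ‖z‖ < 1) : (f z).re = 0 := by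
  have key : ∀ g : ℂ → ℂ, DiffContOnCl ℂ g (Metric.ball 0 1) → (∀ z, ‖z‖ = 1 → (g z).re = 0) →
      (g z).re ≤ 0 := by
    intro g hg hg0
    have h1 : DiffContOnCl ℂ (fun z => Complex.exp (g z)) (Metric.ball 0 1) :=
      ⟨hg.differentiableOn.cexp, hg.continuousOn.cexp⟩
    have h2 := Complex.norm_le_of_forall_mem_frontier_norm_le Metric.isBounded_ball h1 (C := 1)
      (fun w hw => by
        rw [frontier_ball 0 one_ne_zero, mem_sphere_zero_iff_norm] at hw
        rw [Complex.norm_exp, hg0 w hw, Real.exp_zero]) (subset_closure (mem_ball_zero_iff.2 hz))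
    rw [Complex.norm_exp, Real.exp_le_one_iff] at h2
    exact h2
  refine le_antisymm (key f hf h0) ?_
  have := key (fun z => - f z) hf.neg (fun z hz => by simp [h0 z hz])
  simpa using this

theorem eq_on_circle_of_eq_off_finite {f : ℂ → ℝ} (hf : ∀ z, ‖z‖ = 1 → ContinuousAt f z)
    {s : Set ℂ} (hs : s.Finite) (h : ∀ z, ‖z‖ = 1 → z ∉ s → f z = 0) {z : ℂ} (hz : ‖z‖ = 1) :
    f z = 0 := by
  have hfin : {l : UnitAddCircle | (AddCircle.toCircle l : ℂ) ∈ s}.Finite :=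
    hs.preimage (f := fun l : UnitAddCircle => (AddCircle.toCircle l : ℂ))
      (fun a _ b _ h => AddCircle.injective_toCircle one_ne_zero (Subtype.ext h))
  have hnull : ∀ᵐ l : UnitAddCircle, l ∉ {l : UnitAddCircle | (AddCircle.toCircle l : ℂ) ∈ s} :=
    measure_eq_zero_iff_ae_notMem.1 (hfin.measure_zero _)
  have hd := Measure.dense_of_ae hnull
  have hcont : Continuous fun l : UnitAddCircle => f (AddCircle.toCircle l : ℂ) :=
    continuous_iff_continuousAt.2 fun l => (hf _ (Circle.norm_coe _)).comp (f := fun l :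
      UnitAddCircle => (AddCircle.toCircle l : ℂ))
      (continuous_subtype_val.comp AddCircle.continuous_toCircle).continuousAt
  have hev := Continuous.ext_on hd hcont continuous_const
    (g := fun _ => (0 : ℝ)) (fun l hl => h _ (Circle.norm_coe _) hl)
  obtain ⟨x, hx⟩ := (AddCircle.homeomorphCircle (T := 1) one_ne_zero).surjective
    ⟨z, mem_sphere_zero_iff_norm.2 hz⟩
  rw [AddCircle.homeomorphCircle_apply] at hx
  have := congrFun hev x
  simpa [hx] using this

open scoped Classical in
/-- The solutions of `P = a Q` on the unit circle. -/
def circleRoots (a : ℂ) (P Q : Polynomial ℂ) : Finset ℂ :=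
  (Polynomial.C a * Q - P).roots.toFinset.filter fun z => ‖z‖ = 1

namespace IsInnerPair

open Polynomial

variable {P Q : Polynomial ℂ}

theorem sub_ne_zero (h : IsInnerPair P Q) {a : ℂ} (ha : ‖a‖ = 1) {z : ℂ} (hz : ‖z‖ < 1) :
    a * Q.eval z - P.eval z ≠ 0 := fun h0 => by
  have := h.norm_lt z hz
  rw [← sub_eq_zero.1 h0, norm_mul, ha, one_mul] at this
  exact lt_irrefl _ this

theorem mem_circleRoots (h : IsInnerPair P Q) {a : ℂ} (ha : ‖a‖ = 1) {z : ℂ} :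
    z ∈ circleRoots a P Q ↔ ‖z‖ = 1 ∧ P.eval z = a * Q.eval z := by
  have hN : Polynomial.C a * Q - P ≠ 0 := fun h0 => by
    have := congrArg (Polynomial.eval 0) h0
    simp only [eval_sub, eval_mul, eval_C, eval_zero] at this
    exact h.sub_ne_zero ha (by simp) this
  rw [circleRoots, Finset.mem_filter, Multiset.mem_toFinset, mem_roots hN, IsRoot.def, eval_sub,
    eval_mul, eval_C, sub_eq_zero, and_comm, eq_comm (a := a * _)]

theorem kernel_eq_sum (h : IsInnerPair P Q) (hQ : ∀ z : ℂ, ‖z‖ = 1 → Q.eval z ≠ 0)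
    {a : ℂ} (ha : ‖a‖ = 1) {z : ℂ} (hz : ‖z‖ < 1) :
    (1 - ‖P.eval z / Q.eval z‖ ^ 2) / ‖a - P.eval z / Q.eval z‖ ^ 2 =
      ∑ l ∈ circleRoots a P Q, ‖quotDeriv P Q l‖⁻¹ * ((1 - ‖z‖ ^ 2) / ‖l - z‖ ^ 2) := by
  classical
  set S := circleRoots a P Q with hS
  set N := C a * Q - P with hN
  have hNe : ∀ z, N.eval z = a * Q.eval z - P.eval z := fun z => by simp [hN]
  have hSN : ∀ l ∈ S, N.eval l = 0 := fun l hl => by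
    rw [hNe, ((h.mem_circleRoots ha).1 hl).2, sub_self]
  have hdvd : ∀ F : Polynomial ℂ, (∀ l ∈ S, F.eval l = 0) → (∏ l ∈ S, (X - C l)) ∣ F := by
    intro F hF
    refine Finset.prod_dvd_of_coprime ?_ fun l hl => dvd_iff_isRoot.2 (hF l hl)
    intro x _ y _ hxy
    exact pairwise_coprime_X_sub_C Function.injective_id hxy
  obtain ⟨N₁, hN₁⟩ := hdvd N hSN
  set A := ∏ l ∈ S, (X - C l) with hA
  have hAe : ∀ l ∈ S, ∀ z, A.eval z = (z - l) * (∏ m ∈ S.erase l, (X - C m)).eval z := by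
    intro l hl z
    rw [hA, ← Finset.mul_prod_erase _ _ hl]
    simp
  have hA0 : ∀ z, z ∉ S → A.eval z ≠ 0 := by
    intro z hz
    rw [hA, eval_prod, Finset.prod_ne_zero_iff]
    intro l hl
    simp only [eval_sub, eval_X, eval_C]
    exact sub_ne_zero_of_ne fun h => hz (h ▸ hl)
  have hD : ∀ l ∈ S, l * N.derivative.eval l = -‖quotDeriv P Q l‖ * (a * Q.eval l) := by
    intro l hl
    obtain ⟨hl1, hl2⟩ := (h.mem_circleRoots ha).1 hl
    have hq := hQ l hl1
    have h1 := (h.hopf hl1 hq).2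
    rw [hl2, mul_div_assoc, div_self hq, mul_one] at h1
    have h2 : N.derivative.eval l = - quotDeriv P Q l * Q.eval l := by
      simp only [hN, quotDeriv, derivative_sub, derivative_mul, derivative_C, eval_sub, eval_add,
        eval_mul, eval_C, hl2]
      field_simp
      simp
    rw [h2]
    linear_combination (-Q.eval l) * h1
  have hNd : ∀ l ∈ S, N.derivative.eval l =
      (∏ m ∈ S.erase l, (X - C m)).eval l * N₁.eval l := by
    intro l hl
    rw [hN₁, hA, ← Finset.mul_prod_erase _ _ hl]
    simp [derivative_mul]
  have hDpos : ∀ l ∈ S, ‖quotDeriv P Q l‖ ≠ 0 := fun l hl =>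
    (h.hopf ((h.mem_circleRoots ha).1 hl).1 (hQ l ((h.mem_circleRoots ha).1 hl).1)).1.ne'
  have hN₁0 : ∀ z, ‖z‖ ≤ 1 → N₁.eval z ≠ 0 := by
    intro z hz h0
    by_cases hzS : z ∈ S
    · have h1 := hD z hzS
      rw [hNd z hzS, h0, mul_zero, mul_zero, eq_comm, mul_eq_zero, neg_eq_zero,
        Complex.ofReal_eq_zero] at h1
      refine h1.elim (hDpos z hzS) (mul_ne_zero ?_ ?_)
      · rintro rfl; simp at ha
      · exact hQ z ((h.mem_circleRoots ha).1 hzS).1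
    · have h1 : N.eval z = 0 := by rw [hN₁, eval_mul, h0, mul_zero]
      rw [hNe] at h1
      rcases hz.lt_or_eq with hz | hz
      · exact h.sub_ne_zero ha hz h1
      · exact hzS ((h.mem_circleRoots ha).2 ⟨hz, (sub_eq_zero.1 h1).symm⟩)
  set G : Polynomial ℂ := C a * Q + P + N₁ * ∑ l ∈ S,
    C ((‖quotDeriv P Q l‖⁻¹ : ℝ) : ℂ) * (X + C l) * ∏ m ∈ S.erase l, (X - C m) with hG
  have hGS : ∀ l ∈ S, G.eval l = 0 := by
    intro l hl
    rw [hG, eval_add, eval_mul, eval_finsetSum, Finset.sum_eq_single_of_mem l hl]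
    · have h1 := hD l hl
      rw [hNd l hl] at h1
      have h2 : ((‖quotDeriv P Q l‖ : ℝ) : ℂ) ≠ 0 := Complex.ofReal_ne_zero.2 (hDpos l hl)
      have h3 := ((h.mem_circleRoots ha).1 hl).2
      simp only [eval_add, eval_mul, eval_C, eval_X, h3, Complex.ofReal_inv]
      field_simp
      linear_combination 2 * h1
    · intro m hm hml
      rw [eval_mul, eval_prod, Finset.prod_eq_zero (i := l), mul_zero]
      · exact Finset.mem_erase.2 ⟨hml.symm, hl⟩
      · simp
  obtain ⟨W, hW⟩ := hdvd G hGS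
  have hrep : ∀ z, ‖z‖ ≤ 1 → z ∉ S → (a * Q.eval z + P.eval z) / (a * Q.eval z - P.eval z) =
      ∑ l ∈ S, ((‖quotDeriv P Q l‖⁻¹ : ℝ) : ℂ) * ((l + z) / (l - z)) +
        W.eval z / N₁.eval z := by
    intro z hz hzS
    have h1 : G.eval z = A.eval z * W.eval z := by rw [hW, eval_mul]
    have h2 : N.eval z = A.eval z * N₁.eval z := by rw [← eval_mul, ← hN₁]
    have h3 : ∑ l ∈ S, ((‖quotDeriv P Q l‖⁻¹ : ℝ) : ℂ) * ((l + z) / (l - z)) =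
        -(∑ l ∈ S, C ((‖quotDeriv P Q l‖⁻¹ : ℝ) : ℂ) * (X + C l) *
          ∏ m ∈ S.erase l, (X - C m)).eval z / A.eval z := by
      rw [eval_finsetSum, ← Finset.sum_neg_distrib, Finset.sum_div]
      refine Finset.sum_congr rfl fun l hl => ?_
      have h4 := hAe l hl z
      have h5 := hA0 z hzS
      have h6 : z - l ≠ 0 := fun h => by simp [h4, h] at h5
      have h7 : l - z ≠ 0 := fun h => h6 (by linear_combination -h)
      have h8 : (∏ m ∈ S.erase l, (X - C m)).eval z ≠ 0 := fun h => by simp [h4, h] at h5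
      rw [h4]
      simp only [eval_add, eval_mul, eval_C, eval_X]
      field_simp
      ring
    rw [← hNe, h2, h3]
    have h5 := hA0 z hzS
    have h6 := hN₁0 z hz
    rw [hG] at h1
    simp only [eval_add, eval_mul (p := N₁), eval_mul (p := C a), eval_C] at h1
    generalize Polynomial.eval z (∑ l ∈ S, C ((‖quotDeriv P Q l‖⁻¹ : ℝ) : ℂ) * (X + C l) *
      ∏ m ∈ S.erase l, (X - C m)) = s at h1 ⊢
    field_simp
    linear_combination h1
  have hre : ∀ z, ‖z‖ ≤ 1 → z ∉ S →
      (‖Q.eval z‖ ^ 2 - ‖P.eval z‖ ^ 2) / ‖a * Q.eval z - P.eval z‖ ^ 2 =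
      ∑ l ∈ S, ‖quotDeriv P Q l‖⁻¹ * ((‖l‖ ^ 2 - ‖z‖ ^ 2) / ‖l - z‖ ^ 2) +
        (W.eval z / N₁.eval z).re := by
    intro z hz hzS
    have := congrArg Complex.re (hrep z hz hzS)
    rw [re_add_div_sub, Complex.add_re, Complex.re_sum, norm_mul, ha, one_mul] at this
    rw [this]
    congr 1
    refine Finset.sum_congr rfl fun l hl => ?_
    rw [Complex.re_ofReal_mul, re_add_div_sub]
  have hzero : (W.eval z / N₁.eval z).re = 0 := by
    refine re_eq_zero_of_re_eq_zero_on_circle (f := fun z => W.eval z / N₁.eval z) ?_ ?_ hz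
    · constructor
      · exact W.differentiable.differentiableOn.div N₁.differentiable.differentiableOn
          fun z hz => hN₁0 z (mem_ball_zero_iff.1 hz).le
      · refine W.continuous.continuousOn.div N₁.continuous.continuousOn fun z hz => hN₁0 z ?_
        rw [closure_ball _ one_ne_zero] at hz
        exact mem_closedBall_zero_iff.1 hz
    · intro z hz
      refine eq_on_circle_of_eq_off_finite (f := fun z => (W.eval z / N₁.eval z).re)
        (s := S) ?_ S.finite_toSet ?_ hz
      · intro z hz
        exact Complex.continuous_re.continuousAt.comp
          (W.continuous.continuousAt.div N₁.continuous.continuousAt (hN₁0 z hz.le))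
      · intro z hz hzS
        have h1 := hre z hz.le (by simpa using hzS)
        rw [h.norm_eq z hz, sub_self, zero_div, Finset.sum_eq_zero, zero_add] at h1
        · exact h1.symm
        · intro l hl
          rw [((h.mem_circleRoots ha).1 hl).1, hz, sub_self, zero_div, mul_zero]
  have hzS : z ∉ S := fun hzS => hz.ne ((h.mem_circleRoots ha).1 hzS).1
  have h1 := hre z hz.le hzS
  rw [hzero, add_zero] at h1
  have hq := h.ne_zero z hz
  have hq' : ‖Q.eval z‖ ≠ 0 := norm_ne_zero_iff.2 hq
  have h2 : (1 - ‖P.eval z / Q.eval z‖ ^ 2) / ‖a - P.eval z / Q.eval z‖ ^ 2 =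
      (‖Q.eval z‖ ^ 2 - ‖P.eval z‖ ^ 2) / ‖a * Q.eval z - P.eval z‖ ^ 2 := by
    have e : a - P.eval z / Q.eval z = (a * Q.eval z - P.eval z) / Q.eval z := by
      field_simp
    rw [e, norm_div, norm_div, div_pow, div_pow]
    have h3 : ‖a * Q.eval z - P.eval z‖ ≠ 0 := norm_ne_zero_iff.2 (h.sub_ne_zero ha hz)
    field_simp
  rw [h2, h1]
  refine Finset.sum_congr rfl fun l hl => ?_
  rw [((h.mem_circleRoots ha).1 hl).1, one_pow]

end IsInnerPair

theorem integral_comp_toCircle (f : ℂ → ℂ) :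
    ∫ x : UnitAddCircle, f (AddCircle.toCircle x) = Real.circleAverage f 0 1 := by
  rw [← UnitAddCircle.intervalIntegral_preimage 0, Real.circleAverage_def]
  have h := intervalIntegral.integral_comp_mul_left (a := 0) (b := 0 + 1)
    (fun θ : ℝ => f (circleMap 0 1 θ)) (c := 2 * Real.pi) (by positivity)
  rw [zero_add, mul_zero, mul_one] at h
  rw [← h, zero_add]
  refine intervalIntegral.integral_congr fun x _ => ?_
  simp [AddCircle.toCircle_apply_mk, circleMap, Circle.coe_exp]

theorem norm_sub_smul_comm {a b : ℂ} (ha : ‖a‖ = 1) (hb : ‖b‖ = 1) (r : ℝ) :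
    ‖a - r * b‖ = ‖b - r * a‖ := by
  rw [← sq_eq_sq₀ (norm_nonneg _) (norm_nonneg _)]
  have ha' : a.re * a.re + a.im * a.im = 1 := by
    rw [← Complex.normSq_apply, Complex.normSq_eq_norm_sq, ha, one_pow]
  have hb' : b.re * b.re + b.im * b.im = 1 := by
    rw [← Complex.normSq_apply, Complex.normSq_eq_norm_sq, hb, one_pow]
  simp only [← Complex.normSq_eq_norm_sq, Complex.normSq_apply, Complex.sub_re, Complex.sub_im,
    Complex.re_ofReal_mul, Complex.im_ofReal_mul]
  linear_combination (1 - r ^ 2) * ha' - (1 - r ^ 2) * hb'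

theorem integral_fourier_mul_poisson (m : ℤ) (y : UnitAddCircle) {r : ℝ} (hr0 : 0 ≤ r)
    (hr : r < 1) :
    ∫ x : UnitAddCircle, fourier m x *
      (((1 - r ^ 2) / ‖(AddCircle.toCircle y : ℂ) - r * AddCircle.toCircle x‖ ^ 2 : ℝ) : ℂ) =
      (r : ℂ) ^ m.natAbs * fourier m y := by
  have key : ∀ k : ℕ, ∫ x : UnitAddCircle, fourier (k : ℤ) x *
      (((1 - r ^ 2) / ‖(AddCircle.toCircle y : ℂ) - r * AddCircle.toCircle x‖ ^ 2 : ℝ) : ℂ) =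
      (r : ℂ) ^ k * fourier (k : ℤ) y := by
    intro k
    have hy : ‖(AddCircle.toCircle y : ℂ)‖ = 1 := Circle.norm_coe _
    have hw : (r : ℂ) * AddCircle.toCircle y ∈ Metric.ball (0 : ℂ) 1 := by
      rw [mem_ball_zero_iff, norm_mul, hy, mul_one, Complex.norm_real, Real.norm_eq_abs,
        abs_of_nonneg hr0]
      exact hr
    have h := DiffContOnCl.circleAverage_poissonKernel_smul' (f := fun z : ℂ => z ^ k)
      (c := 0) (R := 1) (Differentiable.diffContOnCl (by fun_prop)) hw
    rw [← integral_comp_toCircle, mul_pow] at h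
    simp only [fourier_apply, natCast_zsmul, AddCircle.toCircle_nsmul, Circle.coe_pow]
    rw [← h]
    refine integral_congr_ae (Eventually.of_forall fun x => ?_)
    have hx : ‖(AddCircle.toCircle x : ℂ)‖ = 1 := Circle.norm_coe _
    simp only [sub_zero, hx, norm_mul, hy, Complex.norm_real, Real.norm_eq_abs, mul_one, sq_abs,
      one_pow, Complex.real_smul]
    rw [norm_sub_smul_comm hx hy, mul_comm]
  obtain ⟨k, rfl | rfl⟩ := m.eq_nat_or_neg
  · simpa using key k
  · have := congrArg (starRingEnd ℂ) (key k)
    rw [← integral_conj] at this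
    simp only [map_mul, ← fourier_neg, Complex.conj_ofReal, map_pow] at this
    simpa only [Int.natAbs_neg, Int.natAbs_natCast] using this

open UnitAddTorus in
/-- Finite measures on a torus are determined by their Fourier coefficients. -/
theorem ext_of_integral_mFourier_eq {d : Type*} [Fintype d] {μ ν : Measure (d → UnitAddCircle)}
    [IsFiniteMeasure μ] [IsFiniteMeasure ν]
    (h : ∀ a : d → ℤ, ∫ x, mFourier a x ∂μ = ∫ x, mFourier a x ∂ν) : μ = ν := by
  have hint : ∀ (ρ : Measure (d → UnitAddCircle)) [IsFiniteMeasure ρ]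
      (f : C(UnitAddTorus d, ℂ)), Integrable f ρ := fun ρ _ f =>
    f.continuous.integrable_of_hasCompactSupport (HasCompactSupport.of_compactSpace f)
  let I : ∀ (ρ : Measure (d → UnitAddCircle)) [IsFiniteMeasure ρ],
      C(UnitAddTorus d, ℂ) →L[ℂ] ℂ := fun ρ _ =>
    LinearMap.mkContinuous
      { toFun := fun f => ∫ x, f x ∂ρ
        map_add' := fun f g => integral_add (hint ρ f) (hint ρ g)
        map_smul' := fun c f => integral_const_mul c f }
      (ρ.real univ) fun f => by
        rw [mul_comm]
        exact norm_integral_le_of_norm_le_const (Eventually.of_forall fun x => f.norm_coe_le_norm x)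
  have hI : I μ = I ν := by
    refine ContinuousLinearMap.ext_on (s := range (mFourier (d := d))) ?_ ?_
    · exact Submodule.dense_iff_topologicalClosure_eq_top.2 span_mFourier_closure_eq_top
    · rintro _ ⟨a, rfl⟩
      exact h a
  refine ext_of_forall_integral_eq_of_IsFiniteMeasure fun f => ?_
  have := congrArg (fun J => J ⟨fun x => (f x : ℂ), by fun_prop⟩) hI
  have h2 : ∫ x, (f x : ℂ) ∂μ = ∫ x, (f x : ℂ) ∂ν := this
  rw [integral_complex_ofReal, integral_complex_ofReal] at h2
  exact_mod_cast h2

theorem hasStrictFDerivAt_pEval {n : ℕ} (p : MvPolynomial (Fin n) ℂ)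
    (z : EuclideanSpace ℂ (Fin n)) :
    HasStrictFDerivAt (pEval p)
      (∑ i, pEval (MvPolynomial.pderiv i p) z • (EuclideanSpace.proj i :
        EuclideanSpace ℂ (Fin n) →L[ℂ] ℂ)) z := by
  induction p using MvPolynomial.induction_on with
  | C a =>
    have e : pEval (MvPolynomial.C a : MvPolynomial (Fin n) ℂ) = fun _ => a := by
      funext z; simp [pEval]
    rw [e]
    refine (hasStrictFDerivAt_const (𝕜 := ℂ) a z).congr_fderiv ?_
    ext v
    simp [pEval]
  | add p r hp hr =>
    have e : pEval (p + r) = fun z => pEval p z + pEval r z := by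
      funext z; simp [pEval]
    rw [e]
    refine (hp.add hr).congr_fderiv ?_
    ext v
    simp [pEval, add_mul, Finset.sum_add_distrib]
  | mul_X p j hp =>
    have e : pEval (p * MvPolynomial.X j) = fun z => pEval p z * (EuclideanSpace.proj j :
        EuclideanSpace ℂ (Fin n) →L[ℂ] ℂ) z := by
      funext z; simp [pEval]
    rw [e]
    refine (hp.mul (EuclideanSpace.proj j :
        EuclideanSpace ℂ (Fin n) →L[ℂ] ℂ).hasStrictFDerivAt).congr_fderiv ?_
    ext v
    have e2 : ∀ i, pEval (MvPolynomial.pderiv i (p * MvPolynomial.X j)) z =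
        z j * pEval (MvPolynomial.pderiv i p) z + if i = j then pEval p z else 0 := by
      intro i
      by_cases hij : i = j
      · subst hij
        simp [pEval]
        ring
      · simp [pEval, MvPolynomial.pderiv_X_of_ne (Ne.symm hij), hij]
    simp only [e2]
    simp [ add_mul, Finset.sum_add_distrib, Finset.mul_sum, mul_assoc, add_comm]

/-- The restriction of a polynomial to the complex line through `W`. -/
def slicePoly {n : ℕ} (p : MvPolynomial (Fin n) ℂ) (W : EuclideanSpace ℂ (Fin n)) :
    Polynomial ℂ :=
  MvPolynomial.aeval (fun i => Polynomial.C (W i) * Polynomial.X) p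

theorem eval_slicePoly {n : ℕ} (p : MvPolynomial (Fin n) ℂ) (W : EuclideanSpace ℂ (Fin n))
    (z : ℂ) : (slicePoly p W).eval z = pEval p (z • W) := by
  unfold slicePoly pEval
  induction p using MvPolynomial.induction_on with
  | C a => simp
  | add p r hp hr => simp [hp, hr]
  | mul_X p j hp =>
    simp only [map_mul, Polynomial.eval_mul, hp, MvPolynomial.aeval_X, MvPolynomial.eval_X]
    simp [mul_comm]

theorem mul_eval_derivative_slicePoly {n : ℕ} (p : MvPolynomial (Fin n) ℂ)
    (W : EuclideanSpace ℂ (Fin n)) (z : ℂ) :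
    z * (slicePoly p W).derivative.eval z =
      ∑ i, (z • W) i * pEval (MvPolynomial.pderiv i p) (z • W) := by
  have h1 := (slicePoly p W).hasDerivAt z
  have h2 : HasDerivAt (fun z : ℂ => z • W) W z := by
    simpa using (hasDerivAt_id z).smul_const W
  have h3 := (hasStrictFDerivAt_pEval p (z • W)).hasFDerivAt.comp_hasDerivAt z h2
  have e : (fun z => (slicePoly p W).eval z) = pEval p ∘ fun z : ℂ => z • W :=
    funext fun z => eval_slicePoly p W z
  rw [e] at h1
  rw [h1.unique h3, sum_apply, Finset.mul_sum]
  refine Finset.sum_congr rfl fun i _ => ?_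
  simp
  ring

/-- The derivative of `p / q` in the direction of the Euler vector field. -/
def radDeriv {n : ℕ} (p q : MvPolynomial (Fin n) ℂ) (ζ : EuclideanSpace ℂ (Fin n)) : ℂ :=
  ∑ i, ζ i * ((pEval q ζ * pEval (MvPolynomial.pderiv i p) ζ -
      pEval p ζ * pEval (MvPolynomial.pderiv i q) ζ) / (pEval q ζ) ^ 2)

theorem mul_quotDeriv_slicePoly {n : ℕ} (p q : MvPolynomial (Fin n) ℂ)
    (W : EuclideanSpace ℂ (Fin n)) (z : ℂ) :
    z * quotDeriv (slicePoly p W) (slicePoly q W) z = radDeriv p q (z • W) := by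
  have hp := mul_eval_derivative_slicePoly p W z
  have hq := mul_eval_derivative_slicePoly q W z
  unfold quotDeriv radDeriv
  rw [eval_slicePoly, eval_slicePoly, mul_div_assoc', mul_sub, mul_left_comm, hp,
    mul_left_comm, hq, Finset.mul_sum, Finset.mul_sum, ← Finset.sum_sub_distrib,
    Finset.sum_div]
  refine Finset.sum_congr rfl fun i _ => by ring

theorem torusExp_mem {ι : Type*} (x : ι → UnitAddCircle) : torusExp x ∈ torus ι :=
  fun _ => Circle.norm_coe _

theorem torusExp_diagOrbit {k : ℕ} (w : Fin k → UnitAddCircle) (l m : UnitAddCircle) :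
    torusExp (diagOrbit w (l + m)) = (AddCircle.toCircle l : ℂ) • torusExp (diagOrbit w m) := by
  ext i
  refine Fin.cases ?_ (fun j => ?_) i
  · simp [diagOrbit, AddCircle.toCircle_add]
  · simp [diagOrbit, AddCircle.toCircle_add, mul_assoc]

theorem torusExp_diagOrbit_zero {k : ℕ} (w : Fin k → UnitAddCircle) (l : UnitAddCircle) :
    torusExp (diagOrbit w l) = (AddCircle.toCircle l : ℂ) • torusExp (diagOrbit w 0) := by
  rw [← torusExp_diagOrbit, add_zero]

namespace IsRationalInner

theorem isInnerPair_slicePoly {n : ℕ} {p q : MvPolynomial (Fin n) ℂ}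
    {φ : EuclideanSpace ℂ (Fin n) → ℂ} (h : IsRationalInner n p q φ)
    {W : EuclideanSpace ℂ (Fin n)} (hW : W ∈ torus (Fin n)) :
    IsInnerPair (slicePoly p W) (slicePoly q W) where
  ne_zero z hz := by
    rw [eval_slicePoly]
    exact h.q_ne_zero _ (smul_mem_polydisc hW hz)
  norm_lt z hz := by
    have hm := smul_mem_polydisc hW hz
    have h1 := h.abs_lt_one _ hm
    rw [h.phi_eq _ hm, norm_div, div_lt_one (norm_pos_iff.2 (h.q_ne_zero _ hm))] at h1
    rwa [eval_slicePoly, eval_slicePoly]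
  norm_eq z hz := by
    rw [eval_slicePoly, eval_slicePoly]
    exact h.norm_eval_eq fun j => by simp [hz, hW j]

theorem radDeriv_eq {n : ℕ} {p q : MvPolynomial (Fin n) ℂ}
    {φ : EuclideanSpace ℂ (Fin n) → ℂ} (h : IsRationalInner n p q φ)
    {ζ : EuclideanSpace ℂ (Fin n)} (hζ : ζ ∈ torus (Fin n)) (hq : pEval q ζ ≠ 0) :
    0 < ‖radDeriv p q ζ‖ ∧
      radDeriv p q ζ = ‖radDeriv p q ζ‖ * (pEval p ζ / pEval q ζ) := by
  have h1 := (h.isInnerPair_slicePoly hζ).hopf (l := 1) norm_one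
    (by rwa [eval_slicePoly, one_smul])
  have h2 := mul_quotDeriv_slicePoly p q ζ 1
  rw [one_mul, one_smul] at h2
  rw [h2, one_mul, eval_slicePoly, eval_slicePoly, one_smul] at h1
  exact h1

variable {k : ℕ} {p q : MvPolynomial (Fin (k + 1)) ℂ} {φ : EuclideanSpace ℂ (Fin (k + 1)) → ℂ}

/-- Almost every orbit of the diagonal action avoids the zero set of the denominator. -/
theorem ae_forall_eval_ne_zero (h : IsRationalInner (k + 1) p q φ) :
    ∀ᵐ w : Fin k → UnitAddCircle, ∀ l, pEval q (torusExp (diagOrbit w l)) ≠ 0 := by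
  have hq0 : MvPolynomial.eval 0 q ≠ 0 := h.q_ne_zero 0 fun j => by simp
  obtain ⟨r, hr, hpq⟩ := exists_ne_zero_eval_eq_zero_of_common_zero h.coprime hq0
  have h1 := (measurePreserving_diagOrbit k).quasiMeasurePreserving.ae
    (ae_eval_torusExp_ne_zero hr)
  obtain ⟨l, hl⟩ := (Measure.ae_ae_of_ae_prod h1).exists
  filter_upwards [hl] with w hw m hm
  refine hw (hpq _ (AddCircle.toCircle (m - l) : ℂ) ?_ ?_)
  · have e : pEval p (torusExp (diagOrbit w (m - l + l))) = 0 := by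
      rw [sub_add_cancel, ← norm_eq_zero, h.norm_eval_eq (torusExp_mem _), hm, norm_zero]
    rw [torusExp_diagOrbit] at e
    exact e
  · have e : pEval q (torusExp (diagOrbit w (m - l + l))) = 0 := by
      rw [sub_add_cancel, hm]
    rw [torusExp_diagOrbit] at e
    exact e

end IsRationalInner

/-- The Poisson kernel of the disc at the point `r * exp (2 * π * i * x)`, evaluated at the
boundary point `exp (2 * π * i * y)`. -/
def circlePoisson (r : ℝ) (x y : UnitAddCircle) : ℝ :=
  (1 - r ^ 2) / ‖(AddCircle.toCircle y : ℂ) - r * AddCircle.toCircle x‖ ^ 2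

theorem circlePoisson_denom_pos {r : ℝ} (hr0 : 0 ≤ r) (hr : r < 1) (x y : UnitAddCircle) :
    0 < ‖(AddCircle.toCircle y : ℂ) - r * AddCircle.toCircle x‖ := by
  have h1 : ‖(AddCircle.toCircle y : ℂ)‖ = 1 := Circle.norm_coe _
  have h2 : ‖(r : ℂ) * AddCircle.toCircle x‖ = r := by
    rw [norm_mul, Circle.norm_coe, mul_one, Complex.norm_real, Real.norm_of_nonneg hr0]
  have := norm_sub_norm_le (AddCircle.toCircle y : ℂ) (r * AddCircle.toCircle x)
  linarith

theorem circlePoisson_nonneg {r : ℝ} (hr0 : 0 ≤ r) (hr : r < 1) (x y : UnitAddCircle) :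
    0 ≤ circlePoisson r x y :=
  div_nonneg (by nlinarith) (by positivity)

theorem continuous_circlePoisson {r : ℝ} (hr0 : 0 ≤ r) (hr : r < 1) :
    Continuous fun z : UnitAddCircle × UnitAddCircle => circlePoisson r z.1 z.2 := by
  unfold circlePoisson
  have h1 : Continuous fun z : UnitAddCircle × UnitAddCircle =>
      (AddCircle.toCircle z.2 : ℂ) - r * AddCircle.toCircle z.1 :=
    ((continuous_induced_dom.comp AddCircle.continuous_toCircle).comp continuous_snd).sub
      (continuous_const.mul
        ((continuous_induced_dom.comp AddCircle.continuous_toCircle).comp continuous_fst))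
  exact continuous_const.div (h1.norm.pow 2)
    fun z => pow_ne_zero _ (circlePoisson_denom_pos hr0 hr z.1 z.2).ne'

theorem integral_fourier_mul_circlePoisson (m : ℤ) (y : UnitAddCircle) {r : ℝ} (hr0 : 0 ≤ r)
    (hr : r < 1) :
    ∫ x : UnitAddCircle, fourier m x * (circlePoisson r x y : ℂ) =
      (r : ℂ) ^ m.natAbs * fourier m y :=
  integral_fourier_mul_poisson m y hr0 hr

attribute [irreducible] circlePoisson

section

variable {d : Type*} [Fintype d]

theorem continuous_prod_circlePoisson {r : ℝ} (hr0 : 0 ≤ r) (hr : r < 1) :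
    Continuous fun z : (d → UnitAddCircle) × (d → UnitAddCircle) =>
      ∏ j, circlePoisson r (z.1 j) (z.2 j) := by
  refine continuous_finsetProd _ fun j _ => ?_
  have h1 : Continuous fun z : (d → UnitAddCircle) × (d → UnitAddCircle) => (z.1 j, z.2 j) := by
    fun_prop
  exact (continuous_circlePoisson hr0 hr).comp h1

theorem integrable_mFourier_mul_poisson (μ : Measure (d → UnitAddCircle)) [IsFiniteMeasure μ]
    (a : d → ℤ) {r : ℝ} (hr0 : 0 ≤ r) (hr : r < 1) :
    Integrable (fun z : (d → UnitAddCircle) × (d → UnitAddCircle) =>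
      UnitAddTorus.mFourier a z.1 * ((∏ j, circlePoisson r (z.1 j) (z.2 j) : ℝ) : ℂ))
      (volume.prod μ) := by
  have hc : Continuous fun z : (d → UnitAddCircle) × (d → UnitAddCircle) =>
      UnitAddTorus.mFourier a z.1 * ((∏ j, circlePoisson r (z.1 j) (z.2 j) : ℝ) : ℂ) :=
    ((map_continuous (UnitAddTorus.mFourier a)).comp continuous_fst).mul
      (Complex.continuous_ofReal.comp (continuous_prod_circlePoisson hr0 hr))
  exact hc.integrable_of_hasCompactSupport (HasCompactSupport.of_compactSpace _)

theorem integrable_mFourier_mul_integral_poisson (μ : Measure (d → UnitAddCircle))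
    [IsFiniteMeasure μ] (a : d → ℤ) {r : ℝ} (hr0 : 0 ≤ r) (hr : r < 1) :
    Integrable fun x : d → UnitAddCircle => UnitAddTorus.mFourier a x *
      ((∫ y, ∏ j, circlePoisson r (x j) (y j) ∂μ : ℝ) : ℂ) := by
  have := (integrable_mFourier_mul_poisson μ a hr0 hr).integral_prod_left
  simpa only [integral_const_mul, integral_complex_ofReal] using this

theorem integral_mFourier_mul_integral_poisson (μ : Measure (d → UnitAddCircle))
    [IsFiniteMeasure μ] (a : d → ℤ) {r : ℝ} (hr0 : 0 ≤ r) (hr : r < 1) :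
    ∫ x : d → UnitAddCircle, UnitAddTorus.mFourier a x *
      ((∫ y, ∏ j, circlePoisson r (x j) (y j) ∂μ : ℝ) : ℂ) =
    (∏ j, (r : ℂ) ^ (a j).natAbs) * ∫ y, UnitAddTorus.mFourier a y ∂μ := by
  simp only [← integral_complex_ofReal, ← integral_const_mul]
  rw [integral_integral_swap (integrable_mFourier_mul_poisson μ a hr0 hr)]
  refine integral_congr_ae (Eventually.of_forall fun y => ?_)
  simp only [UnitAddTorus.mFourier, ContinuousMap.coe_mk, Complex.ofReal_prod,
    ← Finset.prod_mul_distrib]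
  rw [integral_fintype_prod_volume_eq_prod
    (fun j x => fourier (a j) x * (circlePoisson r x (y j) : ℂ))]
  exact Finset.prod_congr rfl fun j _ => integral_fourier_mul_circlePoisson (a j) (y j) hr0 hr

end

theorem mFourier_diagOrbit {k : ℕ} (a : Fin (k + 1) → ℤ) (w : Fin k → UnitAddCircle)
    (l : UnitAddCircle) :
    UnitAddTorus.mFourier a (diagOrbit w l) =
      fourier (∑ j, a j) l * UnitAddTorus.mFourier a (diagOrbit w 0) := by
  have h : ∀ j, diagOrbit w l j = l + diagOrbit w 0 j := by
    intro j
    refine Fin.cases ?_ (fun i => ?_) j <;> simp [diagOrbit]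
  have h2 : ∀ s : Finset (Fin (k + 1)), ∏ j ∈ s, fourier (a j) l = fourier (∑ j ∈ s, a j) l := by
    classical
    intro s
    induction s using Finset.induction_on with
    | empty => simp
    | insert i s hi ih => rw [Finset.prod_insert hi, Finset.sum_insert hi, fourier_add, ih]
  simp only [UnitAddTorus.mFourier, ContinuousMap.coe_mk, h]
  rw [← h2, ← Finset.prod_mul_distrib]
  refine Finset.prod_congr rfl fun j _ => ?_
  simp [fourier_apply, AddCircle.toCircle_add, smul_add]

theorem circle_coe_toCircle_injective :
    Function.Injective fun l : UnitAddCircle => (AddCircle.toCircle l : ℂ) :=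
  Subtype.val_injective.comp (AddCircle.injective_toCircle one_ne_zero)

/-- The points of the orbit indexed by `w` at which `p = α * q`. -/
def fiberRoots {k : ℕ} (p q : MvPolynomial (Fin (k + 1)) ℂ) (α : ℂ) (w : Fin k → UnitAddCircle) :
    Finset UnitAddCircle :=
  (circleRoots α (slicePoly p (torusExp (diagOrbit w 0)))
    (slicePoly q (torusExp (diagOrbit w 0)))).preimage
      (fun l : UnitAddCircle => (AddCircle.toCircle l : ℂ))
      circle_coe_toCircle_injective.injOn

namespace IsRationalInner

variable {k : ℕ} {p q : MvPolynomial (Fin (k + 1)) ℂ} {φ : EuclideanSpace ℂ (Fin (k + 1)) → ℂ}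

theorem mem_fiberRoots (h : IsRationalInner (k + 1) p q φ) {α : ℂ} (hα : ‖α‖ = 1)
    {w : Fin k → UnitAddCircle} {l : UnitAddCircle} :
    l ∈ fiberRoots p q α w ↔
      pEval p (torusExp (diagOrbit w l)) = α * pEval q (torusExp (diagOrbit w l)) := by
  rw [fiberRoots, Finset.mem_preimage,
    (h.isInnerPair_slicePoly (torusExp_mem (diagOrbit w 0))).mem_circleRoots hα,
    eval_slicePoly, eval_slicePoly, ← torusExp_diagOrbit_zero]
  exact and_iff_right (Circle.norm_coe _)

/-- The Poisson expansion along an orbit on which the denominator does not vanish. -/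
theorem kernel_eq_sum_fiberRoots (h : IsRationalInner (k + 1) p q φ) {α : ℂ} (hα : ‖α‖ = 1)
    {w : Fin k → UnitAddCircle} (hw : ∀ l, pEval q (torusExp (diagOrbit w l)) ≠ 0)
    {r : ℝ} (hr0 : 0 ≤ r) (hr : r < 1) (m : UnitAddCircle) :
    (1 - ‖φ ((r : ℂ) • torusExp (diagOrbit w m))‖ ^ 2) /
      ‖α - φ ((r : ℂ) • torusExp (diagOrbit w m))‖ ^ 2 =
    ∑ l ∈ fiberRoots p q α w,
      ‖radDeriv p q (torusExp (diagOrbit w l))‖⁻¹ * circlePoisson r m l := by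
  set W := torusExp (diagOrbit w 0) with hW
  have hpair := h.isInnerPair_slicePoly (torusExp_mem (diagOrbit w 0))
  have hz : ‖(r : ℂ) * AddCircle.toCircle m‖ = r := by
    rw [norm_mul, Circle.norm_coe, mul_one, Complex.norm_real, Real.norm_of_nonneg hr0]
  have hsurj : ∀ z : ℂ, ‖z‖ = 1 → ∃ l : UnitAddCircle, (AddCircle.toCircle l : ℂ) = z := by
    intro z hz
    obtain ⟨l, hl⟩ := (AddCircle.homeomorphCircle (one_ne_zero : (1 : ℝ) ≠ 0)).surjective
      (⟨z, mem_sphere_zero_iff_norm.2 hz⟩ : Circle)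
    refine ⟨l, ?_⟩
    rw [AddCircle.homeomorphCircle_apply] at hl
    rw [hl]
  have hQ : ∀ z : ℂ, ‖z‖ = 1 → (slicePoly q W).eval z ≠ 0 := by
    intro z hz
    obtain ⟨l, rfl⟩ := hsurj z hz
    rw [eval_slicePoly, hW, ← torusExp_diagOrbit_zero]
    exact hw l
  have key := hpair.kernel_eq_sum hQ hα (z := (r : ℂ) * AddCircle.toCircle m)
    (by rw [hz]; exact hr)
  have e : (r : ℂ) • torusExp (diagOrbit w m) = ((r : ℂ) * AddCircle.toCircle m) • W := by
    rw [torusExp_diagOrbit_zero, smul_smul]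
  have hm : ((r : ℂ) * AddCircle.toCircle m) • W ∈ polydisc (k + 1) :=
    smul_mem_polydisc (torusExp_mem _) (by rw [hz]; exact hr)
  rw [e, h.phi_eq _ hm, ← eval_slicePoly, ← eval_slicePoly, key, fiberRoots]
  refine (Finset.sum_preimage (fun l : UnitAddCircle => (AddCircle.toCircle l : ℂ)) _
    circle_coe_toCircle_injective.injOn _
    (fun z hz hz' => absurd (hsurj z ((hpair.mem_circleRoots hα).1 hz).1) hz')).symm.trans ?_
  refine Finset.sum_congr rfl fun l _ => ?_
  have h2 := mul_quotDeriv_slicePoly p q W (AddCircle.toCircle l : ℂ)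
  rw [hz, torusExp_diagOrbit_zero w l, ← h2, norm_mul, Circle.norm_coe, one_mul, circlePoisson]

theorem integral_fourier_mul_kernel (h : IsRationalInner (k + 1) p q φ) {α : ℂ} (hα : ‖α‖ = 1)
    (a : Fin (k + 1) → ℤ)
    {w : Fin k → UnitAddCircle} (hw : ∀ l, pEval q (torusExp (diagOrbit w l)) ≠ 0)
    {r : ℝ} (hr0 : 0 ≤ r) (hr : r < 1) :
    ∫ m : UnitAddCircle, UnitAddTorus.mFourier a (diagOrbit w m) *
      (((1 - ‖φ ((r : ℂ) • torusExp (diagOrbit w m))‖ ^ 2) /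
        ‖α - φ ((r : ℂ) • torusExp (diagOrbit w m))‖ ^ 2 : ℝ) : ℂ) =
    (r : ℂ) ^ (∑ j, a j).natAbs * ∑ l ∈ fiberRoots p q α w,
      ((‖radDeriv p q (torusExp (diagOrbit w l))‖⁻¹ : ℝ) : ℂ) *
        UnitAddTorus.mFourier a (diagOrbit w l) := by
  have e : ∀ m : UnitAddCircle, UnitAddTorus.mFourier a (diagOrbit w m) *
      (((1 - ‖φ ((r : ℂ) • torusExp (diagOrbit w m))‖ ^ 2) /
        ‖α - φ ((r : ℂ) • torusExp (diagOrbit w m))‖ ^ 2 : ℝ) : ℂ) =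
      ∑ l ∈ fiberRoots p q α w, (UnitAddTorus.mFourier a (diagOrbit w 0) *
          ((‖radDeriv p q (torusExp (diagOrbit w l))‖⁻¹ : ℝ) : ℂ)) *
          (fourier (∑ j, a j) m * (circlePoisson r m l : ℂ)) := by
    intro m
    rw [h.kernel_eq_sum_fiberRoots hα hw hr0 hr, mFourier_diagOrbit a w m, Complex.ofReal_sum,
      Finset.mul_sum]
    refine Finset.sum_congr rfl fun l _ => ?_
    rw [Complex.ofReal_mul]
    ring
  rw [integral_congr_ae (Eventually.of_forall e), Finset.mul_sum]
  rw [integral_finsetSum]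
  · refine Finset.sum_congr rfl fun l _ => ?_
    rw [integral_const_mul, mFourier_diagOrbit a w l,
      integral_fourier_mul_circlePoisson (∑ j, a j) l hr0 hr]
    ring
  · intro l _
    have hc : Continuous fun m : UnitAddCircle =>
        (UnitAddTorus.mFourier a (diagOrbit w 0) *
          ((‖radDeriv p q (torusExp (diagOrbit w l))‖⁻¹ : ℝ) : ℂ)) *
          (fourier (∑ j, a j) m * (circlePoisson r m l : ℂ)) :=
      continuous_const.mul ((map_continuous (fourier (∑ j, a j))).mul
        (Complex.continuous_ofReal.comp
          ((continuous_circlePoisson hr0 hr).comp (continuous_id.prodMk continuous_const))))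
    exact hc.integrable_of_hasCompactSupport (HasCompactSupport.of_compactSpace _)

/-- The total mass of the fibre measure. -/
theorem sum_fiberRoots (h : IsRationalInner (k + 1) p q φ) {α : ℂ} (hα : ‖α‖ = 1)
    {w : Fin k → UnitAddCircle} (hw : ∀ l, pEval q (torusExp (diagOrbit w l)) ≠ 0) :
    ∑ l ∈ fiberRoots p q α w, ‖radDeriv p q (torusExp (diagOrbit w l))‖⁻¹ =
      (1 - ‖φ 0‖ ^ 2) / ‖α - φ 0‖ ^ 2 := by
  have := h.kernel_eq_sum_fiberRoots hα hw le_rfl zero_lt_one 0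
  simpa [circlePoisson, Circle.norm_coe] using this.symm

end IsRationalInner

namespace IsRationalInner

variable {k : ℕ} {p q : MvPolynomial (Fin (k + 1)) ℂ} {φ : EuclideanSpace ℂ (Fin (k + 1)) → ℂ}

/-- The Fourier coefficients of a measure with the Poisson integral of a Clark measure. -/
theorem integral_mFourier_eq (h : IsRationalInner (k + 1) p q φ) {α : ℂ} (hα : ‖α‖ = 1)
    (μ : Measure (Fin (k + 1) → UnitAddCircle)) [IsFiniteMeasure μ]
    (hμ : ∀ r : ℝ, 0 ≤ r → r < 1 → ∀ x, ∫ y, ∏ j, circlePoisson r (x j) (y j) ∂μ =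
      (1 - ‖φ ((r : ℂ) • torusExp x)‖ ^ 2) / ‖α - φ ((r : ℂ) • torusExp x)‖ ^ 2)
    (a : Fin (k + 1) → ℤ) :
    ∫ y, UnitAddTorus.mFourier a y ∂μ =
      ∫ w : Fin k → UnitAddCircle, ∑ l ∈ fiberRoots p q α w,
        ((‖radDeriv p q (torusExp (diagOrbit w l))‖⁻¹ : ℝ) : ℂ) *
          UnitAddTorus.mFourier a (diagOrbit w l) := by
  set J : ℂ := ∫ w : Fin k → UnitAddCircle, ∑ l ∈ fiberRoots p q α w,
        ((‖radDeriv p q (torusExp (diagOrbit w l))‖⁻¹ : ℝ) : ℂ) *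
          UnitAddTorus.mFourier a (diagOrbit w l) with hJ
  set I : ℂ := ∫ y, UnitAddTorus.mFourier a y ∂μ with hI
  have key : ∀ r : ℝ, 0 ≤ r → r < 1 →
      (∏ j, (r : ℂ) ^ (a j).natAbs) * I = (r : ℂ) ^ (∑ j, a j).natAbs * J := by
    intro r hr0 hr
    rw [hI, ← integral_mFourier_mul_integral_poisson μ a hr0 hr]
    have hint := integrable_mFourier_mul_integral_poisson μ a hr0 hr
    simp only [hμ r hr0 hr] at hint ⊢
    have hmp := measurePreserving_diagOrbit k
    have hint2 := hmp.integrable_comp_of_integrable hint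
    rw [← hmp.map_eq] at hint ⊢
    rw [integral_map hmp.measurable.aemeasurable hint.aestronglyMeasurable, hJ,
      ← integral_const_mul]
    refine (integral_prod_symm _ hint2).trans (integral_congr_ae ?_)
    filter_upwards [h.ae_forall_eval_ne_zero] with w hw
    exact h.integral_fourier_mul_kernel hα a hw hr0 hr
  have hc1 : Continuous fun r : ℝ => (∏ j, (r : ℂ) ^ (a j).natAbs) * I := by fun_prop
  have hc2 : Continuous fun r : ℝ => (r : ℂ) ^ (∑ j, a j).natAbs * J := by fun_prop
  have ht1 := (hc1.tendsto 1).mono_left (nhdsWithin_le_nhds (s := Iio 1))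
  have ht2 := (hc2.tendsto 1).mono_left (nhdsWithin_le_nhds (s := Iio 1))
  have hev : (fun r : ℝ => (∏ j, (r : ℂ) ^ (a j).natAbs) * I) =ᶠ[nhdsWithin 1 (Iio 1)]
      fun r : ℝ => (r : ℂ) ^ (∑ j, a j).natAbs * J := by
    filter_upwards [Ioo_mem_nhdsLT (zero_lt_one' ℝ)] with r hr
    exact key r hr.1.le hr.2
  have := tendsto_nhds_unique (ht1.congr' hev) ht2
  simpa using this

end IsRationalInner

theorem continuous_circlePoisson_prod_right {d : Type*} [Fintype d] {r : ℝ} (hr0 : 0 ≤ r)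
    (hr : r < 1) (x : d → UnitAddCircle) :
    Continuous fun y : d → UnitAddCircle => ∏ j, circlePoisson r (x j) (y j) :=
  (continuous_prod_circlePoisson hr0 hr).comp (continuous_const.prodMk continuous_id)

namespace IsClarkMeasure

variable {n : ℕ} {φ : EuclideanSpace ℂ (Fin n) → ℂ} {α : ℂ}
  {μ : Measure (EuclideanSpace ℂ (Fin n))}

theorem map_comap_torusExp (hμ : IsClarkMeasure n φ α μ) :
    (μ.comap torusExp).map torusExp = μ := by
  rw [measurableEmbedding_torusExp.map_comap, range_torusExp, Measure.restrict_eq_self_of_ae_mem]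
  exact mem_ae_iff.2 hμ.2.1

theorem isFiniteMeasure_comap (hμ : IsClarkMeasure n φ α μ) :
    IsFiniteMeasure (μ.comap torusExp) := by
  have := hμ.1
  infer_instance

theorem integral_circlePoisson (hμ : IsClarkMeasure n φ α μ)
    (hφ : ∀ z ∈ polydisc n, ‖φ z‖ < 1) {r : ℝ} (hr0 : 0 ≤ r) (hr : r < 1)
    (x : Fin n → UnitAddCircle) :
    ∫ y, ∏ j, circlePoisson r (x j) (y j) ∂(μ.comap torusExp) =
      (1 - ‖φ ((r : ℂ) • torusExp x)‖ ^ 2) / ‖α - φ ((r : ℂ) • torusExp x)‖ ^ 2 := by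
  have hm : (r : ℂ) • torusExp x ∈ polydisc n := smul_mem_polydisc (torusExp_mem x) (by
    rwa [Complex.norm_real, Real.norm_of_nonneg hr0])
  have hc := continuous_circlePoisson_prod_right hr0 hr x
  have h1 := hμ.2.2 _ hm
  rw [← hμ.map_comap_torusExp, measurableEmbedding_torusExp.lintegral_map] at h1
  rw [integral_eq_lintegral_of_nonneg_ae
    (Eventually.of_forall fun y => Finset.prod_nonneg fun j _ => circlePoisson_nonneg hr0 hr _ _)
    hc.aestronglyMeasurable]
  have e : ∀ y, ∏ j, circlePoisson r (x j) (y j) =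
      ∏ j, (1 - ‖((r : ℂ) • torusExp x) j‖ ^ 2) /
        ‖torusExp y j - ((r : ℂ) • torusExp x) j‖ ^ 2 := by
    intro y
    refine Finset.prod_congr rfl fun j _ => ?_
    simp [circlePoisson, Circle.norm_coe]
  simp only [e]
  rw [h1, ENNReal.toReal_ofReal]
  have := hφ _ hm
  have h0 := norm_nonneg (φ ((r : ℂ) • torusExp x))
  exact div_nonneg (by nlinarith) (by positivity)

end IsClarkMeasure

/-- The linear map `v ↦ (v_{j+1} - v_0)_j`. -/
def diffMap (k : ℕ) : EuclideanSpace ℝ (Fin (k + 1)) →ₗ[ℝ] EuclideanSpace ℝ (Fin k) where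
  toFun v := WithLp.toLp 2 fun j => v j.succ - v 0
  map_add' v w := by ext j; simp; ring
  map_smul' c v := by ext j; simp; ring

@[simp]
theorem diffMap_apply {k : ℕ} (v : EuclideanSpace ℝ (Fin (k + 1))) (j : Fin k) :
    diffMap k v j = v j.succ - v 0 := rfl

theorem det_cons_succ_sub_zero {k : ℕ} (a : Fin (k + 1) → ℝ) :
    (Matrix.of (Fin.cons a fun j : Fin k => Pi.single j.succ 1 - Pi.single 0 1)).det =
      ∑ i, a i := by
  set Θ : Matrix (Fin (k + 1)) (Fin (k + 1)) ℝ :=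
    Matrix.of (Fin.cons a fun j : Fin k => Pi.single j.succ 1 - Pi.single 0 1) with hΘ
  set L : Matrix (Fin (k + 1)) (Fin (k + 1)) ℝ :=
    Matrix.of fun i j => if j = 0 then 1 else if i = j then 1 else 0 with hL
  have hdL : L.det = 1 := by
    rw [Matrix.det_of_isLowerTriangular]
    · refine Finset.prod_eq_one fun i _ => ?_
      simp [hL]
    · intro i j hij
      have h0 : j ≠ 0 := (Fin.zero_le i |>.trans_lt hij).ne'
      have h1 : i ≠ j := (show i < j from hij).ne
      simp [hL, h0, h1]
  have hcol : ∀ i : Fin (k + 1), i ≠ 0 → (Θ * L) i 0 = 0 := by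
    intro i hi
    obtain ⟨j, rfl⟩ := Fin.exists_succ_eq.2 hi
    simp [hΘ, hL, Matrix.mul_apply]
  have hcol' : ∀ i j : Fin (k + 1), j ≠ 0 → (Θ * L) i j = Θ i j := by
    intro i j hj
    simp [hL, Matrix.mul_apply, hj]
  have h00 : (Θ * L) 0 0 = ∑ i, a i := by simp [hΘ, hL, Matrix.mul_apply]
  have hU : (Θ * L).det = ∑ i, a i := by
    rw [Matrix.det_of_isUpperTriangular]
    · rw [Fin.prod_univ_succ, h00, Finset.prod_eq_one, mul_one]
      intro j _
      rw [hcol' _ _ (Fin.succ_ne_zero j)]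
      simp [hΘ]
    · intro i j hij
      have hij' : j < i := hij
      have hi : i ≠ 0 := (Fin.zero_le j |>.trans_lt hij').ne'
      by_cases hj : j = 0
      · rw [hj]; exact hcol i hi
      · rw [hcol' _ _ hj]
        obtain ⟨l, rfl⟩ := Fin.exists_succ_eq.2 hi
        simp [hΘ, hij'.ne, hj]
  rwa [Matrix.det_mul, hdL, mul_one] at hU

/-- On the hyperplane orthogonal to `a` the map `diffMap` becomes an isometry after a linear
change of coordinates with determinant `‖a‖ / |∑ a_i|`. -/
theorem exists_linearMap_norm_diffMap {k : ℕ} (a : EuclideanSpace ℝ (Fin (k + 1)))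
    (ha : ∑ i, a i ≠ 0) :
    ∃ A : EuclideanSpace ℝ (Fin k) →ₗ[ℝ] EuclideanSpace ℝ (Fin k),
      |LinearMap.det A| = ‖a‖ / |∑ i, a i| ∧
      ∀ v, inner ℝ a v = 0 → ‖A (diffMap k v)‖ = ‖v‖ := by
  have ha0 : a ≠ 0 := by
    rintro rfl
    simp at ha
  have hna : ‖a‖ ≠ 0 := norm_ne_zero_iff.2 ha0
  obtain ⟨b, hb⟩ := Orthonormal.exists_orthonormalBasis_extension_of_card_eq
    (𝕜 := ℝ) (E := EuclideanSpace ℝ (Fin (k + 1))) (ι := Fin (k + 1)) (by simp)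
    (v := fun _ => ‖a‖⁻¹ • a) (s := {0}) (by
      refine ⟨fun i => ?_, fun i j hij => absurd (Subsingleton.elim i j) hij⟩
      simp [norm_smul, hna])
  have hb0 : b 0 = ‖a‖⁻¹ • a := hb 0 rfl
  have hab : ∀ i, inner ℝ a (b i) = if i = 0 then ‖a‖ else 0 := by
    intro i
    have h1 : a = ‖a‖ • b 0 := by rw [hb0, smul_smul, mul_inv_cancel₀ hna, one_smul]
    have h2 := orthonormal_iff_ite.1 b.orthonormal 0 i
    rw [h1, inner_smul_left, h2, norm_smul, b.norm_eq_one]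
    by_cases hi : i = 0 <;> simp [hi, eq_comm]
  set B : Matrix (Fin (k + 1)) (Fin (k + 1)) ℝ := Matrix.of fun i j => b j i with hB
  have hBdet : |B.det| = 1 := by
    have h1 : B.transpose * B = 1 := by
      ext i j
      have h2 := orthonormal_iff_ite.1 b.orthonormal i j
      rw [PiLp.inner_apply] at h2
      simp only [hB, Matrix.mul_apply, Matrix.transpose_apply, Matrix.of_apply, Matrix.one_apply,
        ← h2]
      refine Finset.sum_congr rfl fun l _ => ?_
      simp [mul_comm]
    have h3 := congrArg Matrix.det h1
    rw [Matrix.det_mul, Matrix.det_transpose, Matrix.det_one] at h3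
    have h4 : |B.det| * |B.det| = 1 := by rw [← abs_mul, h3, abs_one]
    nlinarith [abs_nonneg B.det]
  set N : Matrix (Fin k) (Fin k) ℝ := Matrix.of fun i j => b j.succ i.succ - b j.succ 0 with hN
  have hΘB : (Matrix.of (Fin.cons a.ofLp fun j : Fin k => Pi.single j.succ 1 - Pi.single 0 1) * B :
      Matrix (Fin (k + 1)) (Fin (k + 1)) ℝ).det = ‖a‖ * N.det := by
    rw [Matrix.det_succ_row_zero, Finset.sum_eq_single 0]
    · have e0 : (Matrix.of (Fin.cons a.ofLp fun j : Fin k => Pi.single j.succ 1 - Pi.single 0 1) *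
          B : Matrix (Fin (k + 1)) (Fin (k + 1)) ℝ) 0 0 = ‖a‖ := by
        have := hab 0
        rw [PiLp.inner_apply] at this
        simpa [Matrix.mul_apply, hB, mul_comm] using this
      rw [e0]
      have e1 : (Matrix.of (Fin.cons a.ofLp fun j : Fin k => Pi.single j.succ 1 - Pi.single 0 1) *
          B : Matrix (Fin (k + 1)) (Fin (k + 1)) ℝ).submatrix Fin.succ (Fin.succAbove 0) = N := by
        ext i j
        simp [Matrix.mul_apply, hB, hN, sub_mul, Finset.sum_sub_distrib, Pi.single_apply]
      rw [e1]
      simp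
    · intro j _ hj
      have e0 : (Matrix.of (Fin.cons a.ofLp fun j : Fin k => Pi.single j.succ 1 - Pi.single 0 1) *
          B : Matrix (Fin (k + 1)) (Fin (k + 1)) ℝ) 0 j = 0 := by
        have := hab j
        rw [PiLp.inner_apply, if_neg hj] at this
        simpa [Matrix.mul_apply, hB, mul_comm] using this
      rw [e0]
      simp
    · simp
  rw [Matrix.det_mul, det_cons_succ_sub_zero] at hΘB
  have hNabs : |N.det| = |∑ i, a i| / ‖a‖ := by
    have h1 := congrArg abs hΘB
    rw [abs_mul, abs_mul, hBdet, mul_one, abs_norm] at h1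
    rw [eq_div_iff hna, mul_comm, h1]
  have hNdet : N.det ≠ 0 := by
    rw [← abs_ne_zero, hNabs]
    exact div_ne_zero (abs_ne_zero.2 ha) hna
  refine ⟨Matrix.toEuclideanLin N⁻¹, ?_, fun v hv => ?_⟩
  · have e : LinearMap.det (Matrix.toEuclideanLin N⁻¹) = (N⁻¹).det :=
      LinearMap.det_toLin (PiLp.basisFun 2 ℝ (Fin k)) N⁻¹
    rw [e, Matrix.det_nonsing_inv, Ring.inverse_eq_inv', abs_inv, hNabs, inv_div]
  · have hv0 : inner ℝ (b 0) v = 0 := by rw [hb0, inner_smul_left, hv, mul_zero]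
    set y : EuclideanSpace ℝ (Fin k) := WithLp.toLp 2 fun j => inner ℝ (b j.succ) v with hy
    have hsum : v = ∑ j : Fin k, y j • b j.succ := by
      conv_lhs => rw [← b.sum_repr' v, Fin.sum_univ_succ, hv0, zero_smul, zero_add]
    have hS : diffMap k v = Matrix.toEuclideanLin N y := by
      ext i
      rw [Matrix.ofLp_toLpLin, Matrix.toLin'_apply, diffMap_apply, hsum]
      simp [Matrix.mulVec, dotProduct, hN, sub_mul, Finset.sum_sub_distrib, mul_comm]
    have hA : Matrix.toEuclideanLin N⁻¹ (Matrix.toEuclideanLin N y) = y := by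
      ext i
      rw [Matrix.ofLp_toLpLin, Matrix.toLin'_apply, Matrix.ofLp_toLpLin, Matrix.toLin'_apply, Matrix.mulVec_mulVec,
        Matrix.nonsing_inv_mul _ (isUnit_iff_ne_zero.2 hNdet), Matrix.one_mulVec]
    rw [hS, hA, ← sq_eq_sq₀ (norm_nonneg _) (norm_nonneg _), ← b.sum_sq_norm_inner_right v,
      Fin.sum_univ_succ, hv0, EuclideanSpace.norm_sq_eq]
    simp [hy]

/-- The periodic parametrization of the torus by angles. -/
def torusParam {ι : Type*} (t : EuclideanSpace ℝ ι) : EuclideanSpace ℂ ι :=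
  torusExp fun i => (t i : UnitAddCircle)

theorem torusParam_apply {ι : Type*} (t : EuclideanSpace ℝ ι) (i : ι) :
    torusParam t i = Complex.exp (2 * Real.pi * t i * Complex.I) := by
  simp [torusParam, AddCircle.toCircle_apply_mk, Circle.coe_exp]

theorem torusParam_mem {ι : Type*} (t : EuclideanSpace ℝ ι) : torusParam t ∈ torus ι :=
  torusExp_mem _

/-- Pointwise multiplication by `2πi ζ`. -/
def angularDeriv {n : ℕ} (ζ : EuclideanSpace ℂ (Fin n)) :
    EuclideanSpace ℝ (Fin n) →L[ℝ] EuclideanSpace ℂ (Fin n) :=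
  LinearMap.toContinuousLinearMap
    { toFun := fun v => WithLp.toLp 2 fun i => (2 * Real.pi * Complex.I * ζ i) * v i
      map_add' := fun v w => by ext i; simp; ring
      map_smul' := fun c v => by ext i; simp; ring }

@[simp]
theorem angularDeriv_apply {n : ℕ} (ζ : EuclideanSpace ℂ (Fin n)) (v : EuclideanSpace ℝ (Fin n))
    (i : Fin n) : angularDeriv ζ v i = (2 * Real.pi * Complex.I * ζ i) * v i := rfl

theorem norm_angularDeriv {n : ℕ} {ζ : EuclideanSpace ℂ (Fin n)} (hζ : ζ ∈ torus (Fin n))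
    (v : EuclideanSpace ℝ (Fin n)) : ‖angularDeriv ζ v‖ = 2 * Real.pi * ‖v‖ := by
  rw [← sq_eq_sq₀ (norm_nonneg _) (by positivity), mul_pow, EuclideanSpace.norm_sq_eq,
    EuclideanSpace.norm_sq_eq, Finset.mul_sum]
  refine Finset.sum_congr rfl fun i _ => ?_
  simp [hζ i, mul_pow]

theorem hasStrictFDerivAt_torusParam {n : ℕ} (t : EuclideanSpace ℝ (Fin n)) :
    HasStrictFDerivAt torusParam (angularDeriv (torusParam t)) t := by
  rw [hasStrictFDerivAt_piLp]
  intro i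
  have h1 : HasStrictFDerivAt (fun s : EuclideanSpace ℝ (Fin n) => (s i : ℝ))
      (EuclideanSpace.proj i : EuclideanSpace ℝ (Fin n) →L[ℝ] ℝ) t :=
    (EuclideanSpace.proj i : EuclideanSpace ℝ (Fin n) →L[ℝ] ℝ).hasStrictFDerivAt
  have h2 : HasStrictDerivAt (fun x : ℝ => Complex.exp (2 * Real.pi * x * Complex.I))
      (Complex.exp (2 * Real.pi * (t i) * Complex.I) * (2 * Real.pi * Complex.I)) (t i) := by
    have h3 : HasStrictDerivAt (fun x : ℝ => (2 * Real.pi * x * Complex.I : ℂ))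
        (2 * Real.pi * Complex.I) (t i) := by
      have h4 := ((Complex.ofRealCLM.hasStrictDerivAt (x := t i)).const_mul
        (2 * Real.pi : ℂ)).mul_const Complex.I
      simpa using h4
    exact h3.cexp
  have e : (fun s : EuclideanSpace ℝ (Fin n) => torusParam s i) =
      (fun x : ℝ => Complex.exp (2 * Real.pi * x * Complex.I)) ∘ fun s => s i := by
    funext s; exact torusParam_apply s i
  rw [e]
  refine (h2.hasStrictFDerivAt.comp t h1).congr_fderiv ?_
  ext v
  simp [torusParam_apply]
  ring

theorem hasStrictFDerivAt_pEval_torusParam {n : ℕ} (p : MvPolynomial (Fin n) ℂ)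
    (t : EuclideanSpace ℝ (Fin n)) :
    ∃ L : EuclideanSpace ℝ (Fin n) →L[ℝ] ℂ,
      HasStrictFDerivAt (fun s => pEval p (torusParam s)) L t ∧
      ∀ v, L v = 2 * Real.pi * Complex.I *
        ∑ i, torusParam t i * pEval (MvPolynomial.pderiv i p) (torusParam t) * v i := by
  refine ⟨_, ((hasStrictFDerivAt_pEval p (torusParam t)).restrictScalars ℝ).comp t
    (hasStrictFDerivAt_torusParam t), fun v => ?_⟩
  simp [Finset.mul_sum]
  refine Finset.sum_congr rfl fun i _ => by ring

namespace IsRationalInner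

variable {k : ℕ} {p q : MvPolynomial (Fin (k + 1)) ℂ} {φ : EuclideanSpace ℂ (Fin (k + 1)) → ℂ}
  {α : ℂ}

theorem exists_real_gradient (h : IsRationalInner (k + 1) p q φ) (hα : ‖α‖ = 1)
    {t : EuclideanSpace ℝ (Fin (k + 1))} (hq : pEval q (torusParam t) ≠ 0)
    (hp : pEval p (torusParam t) = α * pEval q (torusParam t)) :
    ∃ a : EuclideanSpace ℝ (Fin (k + 1)), ‖a‖ = gradNorm p q (torusParam t) ∧
      |∑ i, a i| = ‖radDeriv p q (torusParam t)‖ ∧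
      ∃ L : EuclideanSpace ℝ (Fin (k + 1)) →L[ℝ] ℂ,
        HasStrictFDerivAt (fun s => pEval p (torusParam s) - α * pEval q (torusParam s)) L t ∧
        ∀ v, ‖L v‖ = 2 * Real.pi * ‖pEval q (torusParam t)‖ * |Inner.inner ℝ a v| := by
  set ζ := torusParam t with hζ
  have hζm : ζ ∈ torus (Fin (k + 1)) := torusParam_mem t
  have hα0 : α ≠ 0 := norm_ne_zero_iff.1 (by rw [hα]; exact one_ne_zero)
  have hαα : (starRingEnd ℂ) α * α = 1 := by
    rw [mul_comm, Complex.mul_conj, Complex.normSq_eq_norm_sq, hα]; simp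
  set c : Fin (k + 1) → ℂ := fun i => ζ i * ((pEval q ζ * pEval (MvPolynomial.pderiv i p) ζ -
      pEval p ζ * pEval (MvPolynomial.pderiv i q) ζ) / (pEval q ζ) ^ 2) with hc
  have hc' : ∀ i, pEval q ζ * c i = ζ i * (pEval (MvPolynomial.pderiv i p) ζ -
      α * pEval (MvPolynomial.pderiv i q) ζ) := by
    intro i
    simp only [hc, hp]
    field_simp
  obtain ⟨Lp, hLp, hLp'⟩ := hasStrictFDerivAt_pEval_torusParam p t
  obtain ⟨Lq, hLq, hLq'⟩ := hasStrictFDerivAt_pEval_torusParam q t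
  have hreal : ∀ i, c i = α * (((starRingEnd ℂ) α * c i).re : ℂ) := by
    intro i
    have hline : HasDerivAt (fun x : ℝ => t + x • EuclideanSpace.single i (1 : ℝ))
        (EuclideanSpace.single i (1 : ℝ)) 0 := by
      simpa using ((hasDerivAt_id (0 : ℝ)).smul_const
        (EuclideanSpace.single i (1 : ℝ))).const_add t
    have ht0 : t = t + (0 : ℝ) • EuclideanSpace.single i (1 : ℝ) := by simp
    have h1 := hasDerivAt_norm_sq_comp (HasFDerivAt.comp_hasDerivAt_of_eq 0 hLp.hasFDerivAt hline ht0)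
    have h2 := hasDerivAt_norm_sq_comp (HasFDerivAt.comp_hasDerivAt_of_eq 0 hLq.hasFDerivAt hline ht0)
    have e : (fun x : ℝ => ‖((fun s => pEval p (torusParam s)) ∘
        fun x : ℝ => t + x • EuclideanSpace.single i (1 : ℝ)) x‖ ^ 2) =
        (fun x : ℝ => ‖((fun s => pEval q (torusParam s)) ∘
        fun x : ℝ => t + x • EuclideanSpace.single i (1 : ℝ)) x‖ ^ 2) := by
      funext x
      simp only [Function.comp_apply]
      rw [h.norm_eval_eq (torusParam_mem _)]
    rw [e] at h1
    have h3 := h1.unique h2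
    simp only [Function.comp_apply, ← ht0, hLp', hLq', ← hζ, hp] at h3
    have h4 : ∀ f : Fin (k + 1) → ℂ, ∑ j, f j * ((EuclideanSpace.single i (1 : ℝ) :
        EuclideanSpace ℝ (Fin (k + 1))) j : ℂ) = f i := by
      intro f
      rw [Finset.sum_eq_single i]
      · simp
      · intro j _ hj; simp [hj]
      · simp
    rw [h4 fun j => ζ j * pEval (MvPolynomial.pderiv j p) ζ,
      h4 fun j => ζ j * pEval (MvPolynomial.pderiv j q) ζ] at h3
    have h5 : (Complex.I * (Complex.normSq (pEval q ζ) * ((starRingEnd ℂ) α * c i))).re = 0 := by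
      have h6 : Complex.I * (Complex.normSq (pEval q ζ) * ((starRingEnd ℂ) α * c i)) =
          (2 * Real.pi : ℝ)⁻¹ * ((starRingEnd ℂ) (α * pEval q ζ) * (2 * Real.pi * Complex.I *
            (ζ i * pEval (MvPolynomial.pderiv i p) ζ)) - (starRingEnd ℂ) (pEval q ζ) *
            (2 * Real.pi * Complex.I * (ζ i * pEval (MvPolynomial.pderiv i q) ζ))) := by
        have hpi : (Real.pi : ℂ) ≠ 0 := by exact_mod_cast Real.pi_ne_zero
        rw [← Complex.mul_conj, map_mul]
        push_cast
        field_simp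
        linear_combination (starRingEnd ℂ) α * (starRingEnd ℂ) (pEval q ζ) * hc' i -
          (starRingEnd ℂ) (pEval q ζ) * ζ i * pEval (MvPolynomial.pderiv i q) ζ * hαα
      rw [h6, Complex.re_ofReal_mul, Complex.sub_re]
      have : ∀ x y : ℝ, 2 * x = 2 * y → x - y = 0 := fun x y hxy => by linarith
      rw [this _ _ h3, mul_zero]
    have h7 : ((starRingEnd ℂ) α * c i).im = 0 := by
      rw [Complex.I_mul_re, Complex.im_ofReal_mul, neg_eq_zero] at h5
      exact (mul_eq_zero.1 h5).resolve_left (by simpa using hq)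
    have h8 : (((starRingEnd ℂ) α * c i).re : ℂ) = (starRingEnd ℂ) α * c i :=
      Complex.ext (by simp) (by simp only [Complex.ofReal_im, h7])
    rw [h8, ← mul_assoc, mul_comm α, hαα, one_mul]
  set a : EuclideanSpace ℝ (Fin (k + 1)) :=
    WithLp.toLp 2 fun i => ((starRingEnd ℂ) α * c i).re with ha
  have hca : ∀ i, c i = α * (a i : ℂ) := hreal
  refine ⟨a, ?_, ?_, Lp - α • Lq, hLp.sub (hLq.const_mul α), fun v => ?_⟩
  · rw [EuclideanSpace.norm_eq, gradNorm]
    congr 1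
    refine Finset.sum_congr rfl fun i _ => ?_
    congr 1
    have h1 : ‖c i‖ = ‖a i‖ := by
      refine (congrArg norm (hca i)).trans ?_
      rw [norm_mul, hα, one_mul, Complex.norm_real]
    rw [← h1]
    simp only [hc]
    rw [norm_mul, hζm i, one_mul]
  · have h1 : radDeriv p q ζ = α * ((∑ i, a i : ℝ) : ℂ) := by
      rw [Complex.ofReal_sum, Finset.mul_sum]
      exact Finset.sum_congr rfl fun i _ => hca i
    rw [h1, norm_mul, hα, one_mul, Complex.norm_real, Real.norm_eq_abs]
  · have h1 : (Lp - α • Lq) v = 2 * Real.pi * Complex.I * (pEval q ζ * (α * ((Inner.inner ℝ a v : ℝ) : ℂ))) := by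
      rw [PiLp.inner_apply]
      simp only [sub_apply, smul_apply, hLp', hLq', ← hζ, smul_eq_mul]
      push_cast
      rw [mul_left_comm α, ← mul_sub]
      congr 1
      simp only [Finset.mul_sum]
      rw [← Finset.sum_sub_distrib]
      refine Finset.sum_congr rfl fun i _ => ?_
      have h2 := hc' i
      rw [hca i] at h2
      simp only [conj_trivial, RCLike.inner_apply, Complex.ofReal_mul]
      linear_combination (-(v i : ℂ)) * h2
    rw [h1]
    simp [hα, abs_of_pos Real.pi_pos, mul_assoc]

end IsRationalInner

theorem exists_ball_norm_sub_sub_le {E F : Type*} [NormedAddCommGroup E] [NormedSpace ℝ E]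
    [NormedAddCommGroup F] [NormedSpace ℝ F] {f : E → F} {L : E →L[ℝ] F} {t : E}
    (h : HasStrictFDerivAt f L t) {ε : ℝ} (hε : 0 < ε) :
    ∃ r > 0, ∀ s ∈ Metric.ball t r, ∀ u ∈ Metric.ball t r,
      ‖f s - f u - L (s - u)‖ ≤ ε * ‖s - u‖ := by
  have h1 := h.isLittleO.def hε
  rw [Metric.eventually_nhds_iff] at h1
  obtain ⟨r, hr, hb⟩ := h1
  refine ⟨r, hr, fun s hs u hu => ?_⟩
  exact hb (y := (s, u)) (by rw [Prod.dist_eq]; exact max_lt hs hu)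

namespace IsRationalInner

variable {k : ℕ} {p q : MvPolynomial (Fin (k + 1)) ℂ} {φ : EuclideanSpace ℂ (Fin (k + 1)) → ℂ}
  {α : ℂ}

/-- Near a point of the level set the torus metric is, up to a factor close to one, the metric
obtained from the differences of the angles by a linear map of known determinant. -/
theorem exists_linearMap_ball (h : IsRationalInner (k + 1) p q φ) (hα : ‖α‖ = 1)
    {t : EuclideanSpace ℝ (Fin (k + 1))} (hq : pEval q (torusParam t) ≠ 0)
    (hp : pEval p (torusParam t) = α * pEval q (torusParam t)) :
    ∃ A : EuclideanSpace ℝ (Fin k) →ₗ[ℝ] EuclideanSpace ℝ (Fin k),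
      |LinearMap.det A| = gradNorm p q (torusParam t) / ‖radDeriv p q (torusParam t)‖ ∧
      ∀ δ > 1, ∃ r > 0, ∀ s ∈ Metric.ball t r, ∀ u ∈ Metric.ball t r,
        pEval p (torusParam s) = α * pEval q (torusParam s) →
        pEval p (torusParam u) = α * pEval q (torusParam u) →
        ‖torusParam s - torusParam u‖ ≤ δ * (2 * Real.pi * ‖A (diffMap k s - diffMap k u)‖) ∧
        2 * Real.pi * ‖A (diffMap k s - diffMap k u)‖ ≤ δ * ‖torusParam s - torusParam u‖ ∧
        ‖s - u‖ ≤ ‖torusParam s - torusParam u‖ := by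
  obtain ⟨a, haG, haD, L, hL, hLn⟩ := h.exists_real_gradient hα hq hp
  have hD : 0 < |∑ i, a i| := by rw [haD]; exact (h.radDeriv_eq (torusParam_mem t) hq).1
  obtain ⟨A, hAdet, hA⟩ := exists_linearMap_norm_diffMap a (abs_pos.1 hD)
  refine ⟨A, by rw [hAdet, haG, haD], fun δ hδ => ?_⟩
  set e : EuclideanSpace ℝ (Fin (k + 1)) := WithLp.toLp 2 fun _ => 1 with he
  have hae : Inner.inner ℝ a e = ∑ i, a i := by
    rw [PiLp.inner_apply]; simp [he]
  have hSe : diffMap k e = 0 := by ext j; simp [he]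
  set D := ∑ i, a i with hDdef
  have hD0 : D ≠ 0 := abs_pos.1 hD
  have he0 : 0 < ‖e‖ := norm_pos_iff.2 fun h0 => hD0 (by rw [← hae, h0, inner_zero_right])
  have hpi := Real.pi_gt_three
  have hAv : ∀ (v : EuclideanSpace ℝ (Fin (k + 1))) (η : ℝ), |Inner.inner ℝ a v| * ‖e‖ ≤ η * |D| →
      |‖A (diffMap k v)‖ - ‖v‖| ≤ η := by
    intro v η hη
    set c := Inner.inner ℝ a v / D with hc
    have h1 : A (diffMap k v) = A (diffMap k (v - c • e)) := by
      rw [map_sub, map_smul, hSe, smul_zero, sub_zero]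
    have h2 : Inner.inner ℝ a (v - c • e) = 0 := by
      rw [inner_sub_right, inner_smul_right, hae, hc, div_mul_cancel₀ _ hD0, sub_self]
    rw [h1, hA _ h2]
    refine (abs_norm_sub_norm_le _ _).trans ?_
    rw [sub_sub_cancel_left, norm_neg, norm_smul, hc, Real.norm_eq_abs, abs_div, div_mul_eq_mul_div,
      div_le_iff₀ hD]
    exact hη
  set ε := min 1 ((δ - 1) / (2 * δ)) with hε
  have hε0 : 0 < ε := lt_min one_pos (div_pos (by linarith) (by linarith))
  have hε1 : ε ≤ 1 := min_le_left _ _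
  have hε2 : ε * (2 * δ) ≤ δ - 1 := by
    rw [← le_div_iff₀ (by linarith)]; exact min_le_right _ _
  set ε' := ε * |D| * (2 * Real.pi * ‖pEval q (torusParam t)‖) / ‖e‖ with hε'
  have hqn : 0 < ‖pEval q (torusParam t)‖ := norm_pos_iff.2 hq
  have hε'0 : 0 < ε' := by positivity
  obtain ⟨r₁, hr₁, hb₁⟩ := exists_ball_norm_sub_sub_le (hasStrictFDerivAt_torusParam t) hε0
  obtain ⟨r₂, hr₂, hb₂⟩ := exists_ball_norm_sub_sub_le hL hε'0
  refine ⟨min r₁ r₂, lt_min hr₁ hr₂, fun s hs u hu hs0 hu0 => ?_⟩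
  have k1 := hb₁ s (Metric.ball_subset_ball (min_le_left _ _) hs) u
    (Metric.ball_subset_ball (min_le_left _ _) hu)
  have k2 := hb₂ s (Metric.ball_subset_ball (min_le_right _ _) hs) u
    (Metric.ball_subset_ball (min_le_right _ _) hu)
  rw [hs0, hu0, sub_self, sub_self, sub_zero, zero_sub, norm_neg, hLn] at k2
  have k3 : |Inner.inner ℝ a (s - u)| * ‖e‖ ≤ (ε * ‖s - u‖) * |D| := by
    rw [hε', div_mul_eq_mul_div, le_div_iff₀ he0] at k2
    have : 0 < 2 * Real.pi * ‖pEval q (torusParam t)‖ := by positivity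
    refine le_of_mul_le_mul_left ?_ this
    linarith
  have k4 := abs_le.1 (hAv _ _ k3)
  rw [map_sub] at k4
  have k5 := abs_le.1 ((abs_norm_sub_norm_le _ _).trans k1)
  rw [norm_angularDeriv (torusParam_mem t)] at k5
  set x := ‖s - u‖
  have hx : 0 ≤ x := norm_nonneg _
  set y := ‖A (diffMap k s - diffMap k u)‖
  set z := ‖torusParam s - torusParam u‖
  have e1 : x ≤ z := by nlinarith
  have e2 : ε * (δ - 1) * x ≥ 0 := by
    have : 0 ≤ δ - 1 := by linarith
    positivity
  have e3 : ε * (2 * δ) * x ≤ (δ - 1) * x := mul_le_mul_of_nonneg_right hε2 hx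
  have e4 : ε * (2 * δ) * x * Real.pi ≤ (δ - 1) * x * Real.pi :=
    mul_le_mul_of_nonneg_right e3 (by linarith)
  have e5 : 0 ≤ ε * x := by positivity
  have e6 : 0 ≤ ε * x * (δ - 1) * Real.pi := by
    have : 0 ≤ δ - 1 := by linarith
    positivity
  refine ⟨?_, ?_, e1⟩
  · have : δ * (2 * Real.pi) * ((1 - ε) * x) ≤ δ * (2 * Real.pi) * y :=
      mul_le_mul_of_nonneg_left (by linarith) (by positivity)
    have e7 : 0 ≤ (δ - 1) * x * (Real.pi - 1) :=
      mul_nonneg (mul_nonneg (by linarith) hx) (by linarith)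
    nlinarith
  · have : 2 * Real.pi * y ≤ 2 * Real.pi * ((1 + ε) * x) :=
      mul_le_mul_of_nonneg_left (by linarith) (by positivity)
    have : δ * ((2 * Real.pi - ε) * x) ≤ δ * z :=
      mul_le_mul_of_nonneg_left (by linarith) (by linarith)
    have e7 : 0 ≤ (δ - 1) * x * (Real.pi - 1) :=
      mul_nonneg (mul_nonneg (by linarith) hx) (by linarith)
    nlinarith

end IsRationalInner

theorem hausdorffMeasure_image_le_of_dist_le {X Y Z : Type*} [MetricSpace X] [MeasurableSpace X]
    [BorelSpace X] [MetricSpace Y] [MeasurableSpace Y] [BorelSpace Y] {f : Z → X} {g : Z → Y}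
    {S : Set Z} {K d : ℝ} (hK : 0 ≤ K) (hd : 0 ≤ d)
    (h : ∀ s ∈ S, ∀ u ∈ S, dist (f s) (f u) ≤ K * dist (g s) (g u)) :
    μH[d] (f '' S) ≤ ENNReal.ofReal (K ^ d) * μH[d] (g '' S) := by
  rcases S.eq_empty_or_nonempty with rfl | ⟨z₀, -⟩
  · simp
  have : Nonempty Z := ⟨z₀⟩
  have hex : ∀ y : Y, y ∈ g '' S → ∃ z, z ∈ S ∧ g z = y := fun _ hy => hy
  choose! i hi hgi using hex
  have himg : f '' S = (f ∘ i) '' (g '' S) := by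
    rw [← image_comp]
    refine image_congr fun s hs => ?_
    have hm := mem_image_of_mem g hs
    have h1 := h s hs (i (g s)) (hi _ hm)
    rw [hgi _ hm, dist_self, mul_zero] at h1
    exact dist_le_zero.1 h1
  have hL : LipschitzOnWith K.toNNReal (f ∘ i) (g '' S) := by
    refine LipschitzOnWith.of_dist_le_mul fun x hx y hy => ?_
    have h1 := h _ (hi x hx) _ (hi y hy)
    rwa [hgi x hx, hgi y hy, ← Real.coe_toNNReal K hK] at h1
  rw [himg]
  refine (hL.hausdorffMeasure_image_le hd).trans_eq ?_
  rw [← ENNReal.ofReal_rpow_of_nonneg hK hd]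
  rfl

theorem hausdorffMeasure_eq_cubeMeasure_smul (k : ℕ) :
    (μH[(k : ℝ)] : Measure (EuclideanSpace ℝ (Fin k))) = cubeMeasure k • volume ∧
      cubeMeasure k ≠ 0 ∧ cubeMeasure k ≠ ⊤ := by
  set c := Measure.addHaarScalarFactor (μH[(k : ℝ)] : Measure (EuclideanSpace ℝ (Fin k))) volume
    with hc
  have h1 : (μH[(k : ℝ)] : Measure (EuclideanSpace ℝ (Fin k))) = c • volume :=
    Measure.isAddLeftInvariant_eq_smul _ _
  have hvol : volume {x : EuclideanSpace ℝ (Fin k) | ∀ i, x i ∈ Icc (0 : ℝ) 1} = 1 := by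
    have e : {x : EuclideanSpace ℝ (Fin k) | ∀ i, x i ∈ Icc (0 : ℝ) 1} =
        WithLp.ofLp ⁻¹' (Set.pi univ fun _ => Icc (0 : ℝ) 1) := by
      ext; simp only [mem_preimage, mem_univ_pi, mem_ofPred_eq]
    rw [e, (PiLp.volume_preserving_ofLp (Fin k)).measure_preimage
      (MeasurableSet.univ_pi fun _ => measurableSet_Icc).nullMeasurableSet, volume_pi_pi]
    simp
  have h2 : cubeMeasure k = c := by
    rw [cubeMeasure, h1, Measure.smul_apply, hvol]
    simp [ENNReal.smul_def]
  have h3 : c ≠ 0 := (Measure.addHaarScalarFactor_pos_of_isAddHaarMeasure _ _).ne'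
  refine ⟨by rw [h1, h2]; rfl, by rw [h2]; exact_mod_cast h3, by rw [h2]; exact ENNReal.coe_ne_top⟩

/-- Reduction modulo one in every coordinate. -/
def angleMk {k : ℕ} (v : EuclideanSpace ℝ (Fin k)) : Fin k → UnitAddCircle :=
  fun j => (v j : UnitAddCircle)

theorem continuous_angleMk {k : ℕ} : Continuous (angleMk (k := k)) :=
  continuous_pi fun j => (AddCircle.continuous_mk' 1).comp (PiLp.continuous_apply 2 _ j)

theorem injOn_angleMk {k : ℕ} (c : Fin k → ℝ) :
    InjOn angleMk {v : EuclideanSpace ℝ (Fin k) | ∀ j, v j ∈ Ioc (c j) (c j + 1)} := by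
  intro v hv w hw h
  ext j
  exact (AddCircle.coe_eq_coe_iff_of_mem_Ioc (hv j) (hw j)).1 (congrFun h j)

theorem volume_image_angleMk {k : ℕ} (c : Fin k → ℝ) {P : Set (EuclideanSpace ℝ (Fin k))}
    (hP : MeasurableSet P) (hPc : ∀ v ∈ P, ∀ j, v j ∈ Ioc (c j) (c j + 1)) :
    volume (angleMk '' P) = volume P := by
  have hmeas : MeasurableSet (angleMk '' P) :=
    hP.image_of_continuousOn_injOn continuous_angleMk.continuousOn ((injOn_angleMk c).mono hPc)
  have hmk : Continuous fun x : Fin k → ℝ => fun i => (x i : UnitAddCircle) :=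
    continuous_pi fun j => (AddCircle.continuous_mk' 1).comp (continuous_apply j)
  have hbox : MeasurableSet (Set.pi univ fun i => Ioc (c i) (c i + 1)) :=
    MeasurableSet.univ_pi fun i => measurableSet_Ioc
  have h1 := (measurePreserving_pi _ _ fun i => UnitAddCircle.measurePreserving_mk
    (c i)).measure_preimage hmeas.nullMeasurableSet
  rw [← Measure.restrict_pi_pi, Measure.restrict_apply (hmk.measurable hmeas)] at h1
  change _ = volume (angleMk '' P) at h1
  rw [← h1, ← volume_pi, ← (PiLp.volume_preserving_ofLp (Fin k)).measure_preimage
    ((hmk.measurable hmeas).inter hbox).nullMeasurableSet]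
  congr 1
  ext v
  constructor
  · rintro ⟨⟨w, hw, hwv⟩, hv⟩
    rwa [← injOn_angleMk c (hPc w hw) (fun j => hv j (mem_univ j)) hwv]
  · intro hv
    exact ⟨⟨v, hv, rfl⟩, fun j _ => hPc v hv j⟩

/-- The differences of the angles. -/
def angleDiff {k : ℕ} (x : Fin (k + 1) → UnitAddCircle) : Fin k → UnitAddCircle :=
  fun j => x j.succ - x 0

theorem continuous_angleDiff {k : ℕ} : Continuous (angleDiff (k := k)) := by
  unfold angleDiff; fun_prop

theorem angleDiff_angleMk {k : ℕ} (t : EuclideanSpace ℝ (Fin (k + 1))) :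
    angleDiff (angleMk t) = angleMk (diffMap k t) := by
  ext j; simp [angleDiff, angleMk]

theorem angleDiff_diagOrbit {k : ℕ} (w : Fin k → UnitAddCircle) (l : UnitAddCircle) :
    angleDiff (diagOrbit w l) = w := by
  ext j; simp [angleDiff, diagOrbit]

theorem diagOrbit_angleDiff {k : ℕ} (x : Fin (k + 1) → UnitAddCircle) :
    diagOrbit (angleDiff x) (x 0) = x := by
  ext j
  refine Fin.cases ?_ (fun j => ?_) j <;> simp [angleDiff, diagOrbit]

theorem torusExp_angleMk {k : ℕ} (t : EuclideanSpace ℝ (Fin k)) :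
    torusExp (angleMk t) = torusParam t := rfl

theorem isOpenMap_angleMk {k : ℕ} : IsOpenMap (angleMk (k := k)) := by
  have h1 : IsOpenMap (Pi.map fun (_ : Fin k) (x : ℝ) => (x : UnitAddCircle)) :=
    IsOpenMap.piMap (fun _ => QuotientAddGroup.isOpenMap_coe) (by simp)
  exact h1.comp (PiLp.homeomorph 2 (fun _ : Fin k => ℝ)).isOpenMap

theorem surjective_angleMk {k : ℕ} : Function.Surjective (angleMk (k := k)) := by
  intro x
  choose t ht using fun j => QuotientAddGroup.mk_surjective (x j)
  exact ⟨WithLp.toLp 2 t, funext ht⟩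

/-- The part of the level set `p = α q` in the torus where `q` does not vanish, in angular
coordinates. -/
def levelSet {n : ℕ} (p q : MvPolynomial (Fin n) ℂ) (α : ℂ) : Set (Fin n → UnitAddCircle) :=
  {x | pEval p (torusExp x) = α * pEval q (torusExp x) ∧ pEval q (torusExp x) ≠ 0}

theorem measurableSet_levelSet {n : ℕ} (p q : MvPolynomial (Fin n) ℂ) (α : ℂ) :
    MeasurableSet (levelSet p q α) := by
  have hc : ∀ r : MvPolynomial (Fin n) ℂ, Continuous fun x => pEval r (torusExp x) :=
    fun r => (continuous_pEval r).comp continuous_torusExp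
  exact (isClosed_eq (hc p) (continuous_const.mul (hc q))).measurableSet.inter
    (isClosed_eq (hc q) continuous_const).isOpen_compl.measurableSet

/-- The normalized `k`-dimensional Hausdorff measure of the torus in angular coordinates. -/
def torusHausdorff (k : ℕ) : Measure (Fin (k + 1) → UnitAddCircle) :=
  (cubeMeasure k)⁻¹ • Measure.comap torusExp μH[(k : ℝ)]

theorem torusHausdorff_apply {k : ℕ} {B : Set (Fin (k + 1) → UnitAddCircle)} :
    torusHausdorff k B = (cubeMeasure k)⁻¹ * μH[(k : ℝ)] (torusExp '' B) := by
  rw [torusHausdorff, Measure.smul_apply, measurableEmbedding_torusExp.comap_apply, smul_eq_mul]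

/-- The density of the image of the level set under `angleDiff` with respect to the Hausdorff
measure of the level set. -/
def fiberDensity {n : ℕ} (p q : MvPolynomial (Fin n) ℂ) (x : Fin n → UnitAddCircle) : ℝ :=
  ‖radDeriv p q (torusExp x)‖ / ((2 * Real.pi) ^ (n - 1) * gradNorm p q (torusExp x))

theorem continuousAt_gradNorm {n : ℕ} {p q : MvPolynomial (Fin n) ℂ}
    {ζ : EuclideanSpace ℂ (Fin n)} (hq : pEval q ζ ≠ 0) : ContinuousAt (gradNorm p q) ζ := by
  have hc : ∀ r : MvPolynomial (Fin n) ℂ, ContinuousAt (pEval r) ζ :=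
    fun r => (continuous_pEval r).continuousAt
  refine Real.continuous_sqrt.continuousAt.comp ?_
  refine tendsto_finsetSum _ fun i _ => ?_
  exact (((((hc _).mul (hc _)).sub ((hc _).mul (hc _))).div ((hc _).pow 2)
    (pow_ne_zero 2 hq)).norm.pow 2)

theorem continuousAt_radDeriv {n : ℕ} {p q : MvPolynomial (Fin n) ℂ}
    {ζ : EuclideanSpace ℂ (Fin n)} (hq : pEval q ζ ≠ 0) : ContinuousAt (radDeriv p q) ζ := by
  have hc : ∀ r : MvPolynomial (Fin n) ℂ, ContinuousAt (pEval r) ζ :=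
    fun r => (continuous_pEval r).continuousAt
  refine tendsto_finsetSum _ fun i _ => ?_
  exact (PiLp.continuous_apply 2 _ i).continuousAt.mul
    ((((hc _).mul (hc _)).sub ((hc _).mul (hc _))).div ((hc _).pow 2) (pow_ne_zero 2 hq))

namespace IsRationalInner

variable {k : ℕ} {p q : MvPolynomial (Fin (k + 1)) ℂ} {φ : EuclideanSpace ℂ (Fin (k + 1)) → ℂ}
  {α : ℂ}

theorem gradNorm_pos (h : IsRationalInner (k + 1) p q φ) {ζ : EuclideanSpace ℂ (Fin (k + 1))}
    (hζ : ζ ∈ torus (Fin (k + 1))) (hq : pEval q ζ ≠ 0) : 0 < gradNorm p q ζ := by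
  have h1 := (h.radDeriv_eq hζ hq).1
  refine (Real.sqrt_nonneg _).lt_of_ne' fun h0 => h1.ne' ?_
  rw [Real.sqrt_eq_zero (Finset.sum_nonneg fun i _ => sq_nonneg _),
    Finset.sum_eq_zero_iff_of_nonneg fun i _ => sq_nonneg _] at h0
  rw [norm_eq_zero]
  refine Finset.sum_eq_zero fun i hi => ?_
  rw [norm_eq_zero.1 (pow_eq_zero_iff two_ne_zero |>.1 (h0 i hi)), mul_zero]

theorem fiberDensity_pos (h : IsRationalInner (k + 1) p q φ)
    {x : Fin (k + 1) → UnitAddCircle} (hx : x ∈ levelSet p q α) : 0 < fiberDensity p q x := by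
  have := h.gradNorm_pos (torusExp_mem x) hx.2
  have := (h.radDeriv_eq (torusExp_mem x) hx.2).1
  have := Real.pi_pos
  unfold fiberDensity
  positivity

theorem continuousAt_fiberDensity (h : IsRationalInner (k + 1) p q φ)
    {x : Fin (k + 1) → UnitAddCircle} (hx : x ∈ levelSet p q α) :
    ContinuousAt (fiberDensity p q) x := by
  have h1 : ContinuousAt (fun x => gradNorm p q (torusExp x)) x :=
    (continuousAt_gradNorm hx.2).comp continuous_torusExp.continuousAt
  have h2 : ContinuousAt (fun x => radDeriv p q (torusExp x)) x :=
    (continuousAt_radDeriv hx.2).comp continuous_torusExp.continuousAt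
  have := h.gradNorm_pos (torusExp_mem x) hx.2
  have := Real.pi_pos
  exact h2.norm.div (continuousAt_const.mul h1) (by positivity)

theorem exists_nhds_torusHausdorff (h : IsRationalInner (k + 1) p q φ) (hα : ‖α‖ = 1)
    {x : Fin (k + 1) → UnitAddCircle} (hx : x ∈ levelSet p q α) {δ : ℝ} (hδ : 1 < δ) :
    ∃ U ∈ nhds x, InjOn angleDiff (U ∩ levelSet p q α) ∧
      ∀ B ⊆ U ∩ levelSet p q α, MeasurableSet B →
        torusHausdorff k B ≤
          ENNReal.ofReal (δ ^ k * (fiberDensity p q x)⁻¹) * volume (angleDiff '' B) ∧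
        volume (angleDiff '' B) ≤
          ENNReal.ofReal (δ ^ k * fiberDensity p q x) * torusHausdorff k B := by
  obtain ⟨t, rfl⟩ := surjective_angleMk x
  obtain ⟨hp, hq⟩ := hx
  have hG := h.gradNorm_pos (torusExp_mem _) hq
  have hD := (h.radDeriv_eq (torusExp_mem _) hq).1
  rw [torusExp_angleMk] at hp hq hG hD
  obtain ⟨A, hA, hAr⟩ := h.exists_linearMap_ball hα hq hp
  obtain ⟨r₀, hr₀, hb⟩ := hAr δ hδ
  have hpi := Real.pi_pos
  set r := min r₀ (1 / 8) with hr
  have hrpos : 0 < r := lt_min hr₀ (by norm_num)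
  have hbr : Metric.ball t r ⊆ Metric.ball t r₀ := Metric.ball_subset_ball (min_le_left _ _)
  have hbox : ∀ s ∈ Metric.ball t r, ∀ j, diffMap k s j ∈
      Ioc (diffMap k t j - 1 / 2) (diffMap k t j - 1 / 2 + 1) := by
    intro s hs j
    have h1 : ∀ i, |s i - t i| < 1 / 8 := fun i =>
      ((PiLp.norm_apply_le (s - t) i).trans_lt (mem_ball_iff_norm.1 hs)).trans_le (min_le_right _ _)
    have h2 := abs_lt.1 (h1 j.succ)
    have h3 := abs_lt.1 (h1 0)
    simp only [diffMap_apply]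
    constructor <;> linarith
  set W : Set (EuclideanSpace ℝ (Fin (k + 1))) := {s ∈ Metric.ball t r |
    pEval p (torusParam s) = α * pEval q (torusParam s)} with hW
  have hinj : InjOn (diffMap k) W := by
    intro s hs u hu hsu
    obtain ⟨h1, -, h3⟩ := hb s (hbr hs.1) u (hbr hu.1) hs.2 hu.2
    rw [hsu, sub_self, map_zero, norm_zero, mul_zero, mul_zero] at h1
    exact sub_eq_zero.1 (norm_le_zero_iff.1 (h3.trans h1))
  have hinjmk : InjOn (fun s => angleMk (diffMap k s)) W := by
    intro s hs u hu hsu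
    exact hinj hs hu (injOn_angleMk _ (hbox s hs.1) (hbox u hu.1) hsu)
  have hcont : Continuous (diffMap k) := (diffMap k).continuous_of_finiteDimensional
  refine ⟨angleMk '' Metric.ball t r, isOpenMap_angleMk.image_mem_nhds
    (Metric.ball_mem_nhds t hrpos), ?_, fun B hBU hB => ?_⟩
  · rintro _ ⟨⟨s, hs, rfl⟩, hs'⟩ _ ⟨⟨u, hu, rfl⟩, hu'⟩ hsu
    rw [angleDiff_angleMk, angleDiff_angleMk] at hsu
    rw [hinjmk ⟨hs, hs'.1⟩ ⟨hu, hu'.1⟩ hsu]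
  · set S := Metric.ball t r ∩ angleMk ⁻¹' B with hS
    have hSm : MeasurableSet S := measurableSet_ball.inter (continuous_angleMk.measurable hB)
    have hSB : angleMk '' S = B := by
      rw [hS, image_inter_preimage, inter_eq_right]
      exact hBU.trans inter_subset_left
    have hSW : S ⊆ W := fun s hs => ⟨hs.1, (hBU hs.2).2.1⟩
    have e1 : torusExp '' B = torusParam '' S := by
      rw [← hSB, ← image_comp]; rfl
    have e2 : angleDiff '' B = angleMk '' (diffMap k '' S) := by
      rw [← hSB, ← image_comp, ← image_comp]
      exact image_congr fun s _ => angleDiff_angleMk s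
    have hPm : MeasurableSet (diffMap k '' S) :=
      hSm.image_of_continuousOn_injOn hcont.continuousOn (hinj.mono hSW)
    have e3 : volume (angleDiff '' B) = volume (diffMap k '' S) := by
      rw [e2]
      refine volume_image_angleMk (fun j => diffMap k t j - 1 / 2) hPm ?_
      rintro _ ⟨s, hs, rfl⟩ j
      exact hbox s hs.1 j
    obtain ⟨hH, hc0, hct⟩ := hausdorffMeasure_eq_cubeMeasure_smul k
    have e4 : μH[(k : ℝ)] ((fun s => A (diffMap k s)) '' S) =
        ENNReal.ofReal (gradNorm p q (torusParam t) / ‖radDeriv p q (torusParam t)‖) *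
          (cubeMeasure k * volume (angleDiff '' B)) := by
      have : (fun s => A (diffMap k s)) '' S = A '' (diffMap k '' S) := by rw [← image_comp]; rfl
      rw [this, Measure.addHaar_image_linearMap, hA, e3, hH, Measure.smul_apply, smul_eq_mul]
    have hk : (0 : ℝ) ≤ k := Nat.cast_nonneg k
    have i1 : μH[(k : ℝ)] (torusParam '' S) ≤ ENNReal.ofReal ((δ * (2 * Real.pi)) ^ (k : ℝ)) *
        μH[(k : ℝ)] ((fun s => A (diffMap k s)) '' S) := by
      refine hausdorffMeasure_image_le_of_dist_le (by positivity) hk fun s hs u hu => ?_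
      have h1 := (hb s (hbr hs.1) u (hbr hu.1) (hSW hs).2 (hSW hu).2).1
      rwa [dist_eq_norm, dist_eq_norm, ← map_sub, mul_assoc]
    have i2 : μH[(k : ℝ)] ((fun s => A (diffMap k s)) '' S) ≤
        ENNReal.ofReal ((δ / (2 * Real.pi)) ^ (k : ℝ)) * μH[(k : ℝ)] (torusParam '' S) := by
      refine hausdorffMeasure_image_le_of_dist_le (by positivity) hk fun s hs u hu => ?_
      have h1 := (hb s (hbr hs.1) u (hbr hu.1) (hSW hs).2 (hSW hu).2).2.1
      rw [dist_eq_norm, dist_eq_norm, ← map_sub, div_mul_eq_mul_div, le_div_iff₀ (by positivity),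
        mul_comm _ (2 * Real.pi)]
      exact h1
    rw [e4, Real.rpow_natCast] at i1 i2
    rw [torusHausdorff_apply, e1]
    have hfd : fiberDensity p q (angleMk t) = ‖radDeriv p q (torusParam t)‖ /
      ((2 * Real.pi) ^ k * gradNorm p q (torusParam t)) := rfl
    rw [hfd]
    set G := gradNorm p q (torusParam t)
    set D := ‖radDeriv p q (torusParam t)‖
    set m := volume (angleDiff '' B)
    set H := μH[(k : ℝ)] (torusParam '' S)
    constructor
    · calc (cubeMeasure k)⁻¹ * H ≤ (cubeMeasure k)⁻¹ * (ENNReal.ofReal ((δ * (2 * Real.pi)) ^ k) *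
            (ENNReal.ofReal (G / D) * (cubeMeasure k * m))) := by gcongr
        _ = ((cubeMeasure k)⁻¹ * cubeMeasure k) *
            ((ENNReal.ofReal ((δ * (2 * Real.pi)) ^ k) * ENNReal.ofReal (G / D)) * m) := by ring
        _ = _ := by
          rw [ENNReal.inv_mul_cancel hc0 hct, one_mul, ← ENNReal.ofReal_mul (by positivity)]
          congr 2
          simp only [mul_pow]
          field_simp
    · calc m = ((cubeMeasure k)⁻¹ * cubeMeasure k) * (ENNReal.ofReal (D / G) *
            ENNReal.ofReal (G / D)) * m := by
            rw [ENNReal.inv_mul_cancel hc0 hct, ← ENNReal.ofReal_mul (by positivity),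
              div_mul_div_cancel₀ hG.ne', div_self hD.ne', ENNReal.ofReal_one, one_mul, one_mul]
        _ = (cubeMeasure k)⁻¹ * (ENNReal.ofReal (D / G) *
            (ENNReal.ofReal (G / D) * (cubeMeasure k * m))) := by ring
        _ ≤ (cubeMeasure k)⁻¹ * (ENNReal.ofReal (D / G) *
            (ENNReal.ofReal ((δ / (2 * Real.pi)) ^ k) * H)) := by gcongr
        _ = (ENNReal.ofReal (D / G) * ENNReal.ofReal ((δ / (2 * Real.pi)) ^ k)) *
            ((cubeMeasure k)⁻¹ * H) := by ring
        _ = _ := by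
          rw [← ENNReal.ofReal_mul (by positivity)]
          congr 2
          simp only [mul_pow, div_pow]
          field_simp

end IsRationalInner

theorem exists_measurable_partition {X : Type*} [TopologicalSpace X] [SecondCountableTopology X]
    [MeasurableSpace X] [OpensMeasurableSpace X] {V : Set X} (hV : MeasurableSet V)
    {P : Set X → Prop} (h0 : P ∅) (hmono : ∀ S T, S ⊆ T → P T → P S)
    (h : ∀ x ∈ V, ∃ U ∈ nhds x, P (U ∩ V)) :
    ∃ E : ℕ → Set X, (∀ i, MeasurableSet (E i)) ∧ Pairwise (Function.onFun Disjoint E) ∧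
      ⋃ i, E i = V ∧ ∀ i, P (E i) := by
  rcases V.eq_empty_or_nonempty with rfl | hne
  · exact ⟨fun _ => ∅, fun _ => MeasurableSet.empty, fun i j _ => disjoint_bot_left,
      by simp, fun _ => h0⟩
  have h' : ∀ x : X, ∃ U : Set X, IsOpen U ∧ (x ∈ V → x ∈ U) ∧ P (U ∩ V) := by
    intro x
    by_cases hx : x ∈ V
    · obtain ⟨U, hU, hPU⟩ := h x hx
      exact ⟨interior U, isOpen_interior, fun _ => mem_interior_iff_mem_nhds.2 hU,
        hmono _ _ (inter_subset_inter_left _ interior_subset) hPU⟩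
    · exact ⟨∅, isOpen_empty, fun hx' => absurd hx' hx, by simpa using h0⟩
  choose U hUo hUm hUP using h'
  obtain ⟨t, htV, htc, htU⟩ := TopologicalSpace.countable_cover_nhdsWithin (s := V) (f := U)
    fun x hx => mem_nhdsWithin_of_mem_nhds ((hUo x).mem_nhds (hUm x hx))
  have htne : t.Nonempty := by
    obtain ⟨x, hx⟩ := hne
    obtain ⟨y, hy, -⟩ := mem_iUnion₂.1 (htU hx)
    exact ⟨y, hy⟩
  obtain ⟨f, rfl⟩ := htc.exists_eq_range htne
  refine ⟨disjointed fun i => U (f i) ∩ V,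
    fun i => MeasurableSet.disjointed (fun i => (hUo _).measurableSet.inter hV) i,
    disjoint_disjointed _, ?_, fun i => hmono _ _ (disjointed_subset _ i) (hUP _)⟩
  rw [iUnion_disjointed, ← iUnion_inter, inter_eq_right]
  refine htU.trans ?_
  simp

/-- The Hausdorff measure of the level set, weighted so that it locally projects to the Lebesgue
measure under `angleDiff`. -/
def fiberMeasure {k : ℕ} (p q : MvPolynomial (Fin (k + 1)) ℂ) (α : ℂ) :
    Measure (Fin (k + 1) → UnitAddCircle) :=
  ((torusHausdorff k).restrict (levelSet p q α)).withDensity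
    fun x => ENNReal.ofReal (fiberDensity p q x)

theorem fiberMeasure_apply {k : ℕ} {p q : MvPolynomial (Fin (k + 1)) ℂ} {α : ℂ}
    {B : Set (Fin (k + 1) → UnitAddCircle)} (hB : MeasurableSet B) (hBV : B ⊆ levelSet p q α) :
    fiberMeasure p q α B = ∫⁻ x in B, ENNReal.ofReal (fiberDensity p q x) ∂torusHausdorff k := by
  rw [fiberMeasure, withDensity_apply _ hB, Measure.restrict_restrict hB,
    inter_eq_left.2 hBV]

namespace IsRationalInner

variable {k : ℕ} {p q : MvPolynomial (Fin (k + 1)) ℂ} {φ : EuclideanSpace ℂ (Fin (k + 1)) → ℂ}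
  {α : ℂ}

theorem exists_nhds_fiberMeasure (h : IsRationalInner (k + 1) p q φ) (hα : ‖α‖ = 1)
    {x : Fin (k + 1) → UnitAddCircle} (hx : x ∈ levelSet p q α) {δ : ℝ} (hδ : 1 < δ) :
    ∃ U ∈ nhds x, InjOn angleDiff (U ∩ levelSet p q α) ∧
      ∀ B ⊆ U ∩ levelSet p q α, MeasurableSet B →
        fiberMeasure p q α B ≤ ENNReal.ofReal (δ ^ (k + 1)) * volume (angleDiff '' B) ∧
        volume (angleDiff '' B) ≤ ENNReal.ofReal (δ ^ (k + 1)) * fiberMeasure p q α B := by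
  obtain ⟨U, hU, hinj, hUB⟩ := h.exists_nhds_torusHausdorff hα hx hδ
  have hpos := h.fiberDensity_pos hx
  set f := fiberDensity p q x with hf
  have hc := h.continuousAt_fiberDensity hx
  have ev1 : ∀ᶠ y in nhds x, fiberDensity p q y < δ * f :=
    hc.eventually_lt_const (lt_mul_of_one_lt_left hpos hδ)
  have ev2 : ∀ᶠ y in nhds x, f / δ < fiberDensity p q y :=
    hc.eventually_const_lt (div_lt_self hpos hδ)
  refine ⟨U ∩ {y | fiberDensity p q y < δ * f ∧ f / δ < fiberDensity p q y},
    inter_mem hU (ev1.and ev2), hinj.mono (inter_subset_inter_left _ inter_subset_left),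
    fun B hB hBm => ?_⟩
  obtain ⟨h1, h2⟩ := hUB B (hB.trans (inter_subset_inter_left _ inter_subset_left)) hBm
  rw [fiberMeasure_apply hBm (hB.trans inter_subset_right)]
  have hδ0 : 0 < δ := one_pos.trans hδ
  constructor
  · calc ∫⁻ x in B, ENNReal.ofReal (fiberDensity p q x) ∂torusHausdorff k
        ≤ ∫⁻ x in B, ENNReal.ofReal (δ * f) ∂torusHausdorff k :=
          setLIntegral_mono' hBm fun y hy => ENNReal.ofReal_le_ofReal (hB hy).1.2.1.le
      _ = ENNReal.ofReal (δ * f) * torusHausdorff k B := setLIntegral_const _ _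
      _ ≤ ENNReal.ofReal (δ * f) * (ENNReal.ofReal (δ ^ k * f⁻¹) * volume (angleDiff '' B)) := by
          gcongr
      _ = _ := by
          rw [← mul_assoc, ← ENNReal.ofReal_mul (by positivity)]
          congr 2
          field_simp
          ring
  · calc volume (angleDiff '' B) ≤ ENNReal.ofReal (δ ^ k * f) * torusHausdorff k B := h2
      _ = ENNReal.ofReal (δ ^ (k + 1)) * (ENNReal.ofReal (f / δ) * torusHausdorff k B) := by
          rw [← mul_assoc, ← ENNReal.ofReal_mul (by positivity)]
          congr 2
          field_simp
          ring
      _ = ENNReal.ofReal (δ ^ (k + 1)) * ∫⁻ x in B, ENNReal.ofReal (f / δ) ∂torusHausdorff k := by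
          rw [setLIntegral_const]
      _ ≤ _ := by
          refine mul_le_mul' le_rfl (setLIntegral_mono' hBm fun y hy =>
            ENNReal.ofReal_le_ofReal (hB hy).1.2.2.le)

theorem measurableSet_image_angleDiff {B : Set (Fin (k + 1) → UnitAddCircle)}
    (hB : MeasurableSet B) (hinj : InjOn angleDiff B) : MeasurableSet (angleDiff '' B) :=
  hB.image_of_continuousOn_injOn continuous_angleDiff.continuousOn hinj

/-- On sets where `angleDiff` is injective, it is measure preserving. -/
theorem fiberMeasure_eq_volume_image (h : IsRationalInner (k + 1) p q φ) (hα : ‖α‖ = 1)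
    {B : Set (Fin (k + 1) → UnitAddCircle)} (hB : MeasurableSet B) (hBV : B ⊆ levelSet p q α)
    (hinj : InjOn angleDiff B) : fiberMeasure p q α B = volume (angleDiff '' B) := by
  have key : ∀ δ : ℝ, 1 < δ →
      fiberMeasure p q α B ≤ ENNReal.ofReal (δ ^ (k + 1)) * volume (angleDiff '' B) ∧
        volume (angleDiff '' B) ≤ ENNReal.ofReal (δ ^ (k + 1)) * fiberMeasure p q α B := by
    intro δ hδ
    obtain ⟨E, hEm, hEd, hEV, hE⟩ := exists_measurable_partition (measurableSet_levelSet p q α)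
      (P := fun S => ∀ B ⊆ S, MeasurableSet B →
        fiberMeasure p q α B ≤ ENNReal.ofReal (δ ^ (k + 1)) * volume (angleDiff '' B) ∧
        volume (angleDiff '' B) ≤ ENNReal.ofReal (δ ^ (k + 1)) * fiberMeasure p q α B)
      (fun B hB _ => by rw [subset_empty_iff.1 hB]; simp)
      (fun S T hST hT B hB => hT B (hB.trans hST))
      (fun x hx => by
        obtain ⟨U, hU, -, hUB⟩ := h.exists_nhds_fiberMeasure hα hx hδ
        exact ⟨U, hU, hUB⟩)
    have hBu : B = ⋃ i, B ∩ E i := by rw [← inter_iUnion, hEV, inter_eq_left.2 hBV]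
    have hdis : Pairwise (Function.onFun Disjoint fun i => B ∩ E i) := fun i j hij =>
      (hEd hij).mono inter_subset_right inter_subset_right
    have s1 : fiberMeasure p q α B = ∑' i, fiberMeasure p q α (B ∩ E i) := by
      conv_lhs => rw [hBu]
      exact measure_iUnion hdis fun i => hB.inter (hEm i)
    have s2 : volume (angleDiff '' B) = ∑' i, volume (angleDiff '' (B ∩ E i)) := by
      conv_lhs => rw [hBu, image_iUnion]
      refine measure_iUnion (fun i j hij => ?_) fun i =>
        measurableSet_image_angleDiff (hB.inter (hEm i)) (hinj.mono inter_subset_left)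
      refine Set.disjoint_left.2 ?_
      rintro _ ⟨a, ha, rfl⟩ ⟨b, hb, hba⟩
      have hab := hinj hb.1 ha.1 hba
      subst hab
      exact Set.disjoint_left.1 (hdis hij) ha hb
    rw [s1, s2, ← ENNReal.tsum_mul_left, ← ENNReal.tsum_mul_left]
    exact ⟨ENNReal.tsum_le_tsum fun i => (hE i _ inter_subset_right (hB.inter (hEm i))).1,
      ENNReal.tsum_le_tsum fun i => (hE i _ inter_subset_right (hB.inter (hEm i))).2⟩
  have lim : ∀ a : ℝ≥0∞, Tendsto (fun δ : ℝ => ENNReal.ofReal (δ ^ (k + 1)) * a)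
      (nhdsWithin 1 (Ioi 1)) (nhds a) := by
    intro a
    have h1 : Tendsto (fun δ : ℝ => ENNReal.ofReal (δ ^ (k + 1))) (nhdsWithin 1 (Ioi 1))
        (nhds 1) := by
      have : Continuous fun δ : ℝ => ENNReal.ofReal (δ ^ (k + 1)) :=
        ENNReal.continuous_ofReal.comp (continuous_pow _)
      have h1 := this.tendsto (1 : ℝ)
      simp only [one_pow, ENNReal.ofReal_one] at h1
      exact h1.mono_left nhdsWithin_le_nhds
    simpa using ENNReal.Tendsto.mul_const h1 (b := a) (Or.inl one_ne_zero)
  refine le_antisymm (ge_of_tendsto (lim _) ?_) (ge_of_tendsto (lim _) ?_)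
  · filter_upwards [self_mem_nhdsWithin] with δ hδ using (key δ hδ).1
  · filter_upwards [self_mem_nhdsWithin] with δ hδ using (key δ hδ).2

end IsRationalInner

/-- The counting measure of the intersection of the level set with the orbit indexed by `w`. -/
def fiberCount {k : ℕ} (p q : MvPolynomial (Fin (k + 1)) ℂ) (α : ℂ) (w : Fin k → UnitAddCircle) :
    Measure (Fin (k + 1) → UnitAddCircle) :=
  Measure.count.restrict (levelSet p q α ∩ angleDiff ⁻¹' {w})

theorem measurable_radDeriv {n : ℕ} (p q : MvPolynomial (Fin n) ℂ) :
    Measurable fun x : Fin n → UnitAddCircle => radDeriv p q (torusExp x) := by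
  have hc : ∀ r : MvPolynomial (Fin n) ℂ, Measurable fun x => pEval r (torusExp x) :=
    fun r => ((continuous_pEval r).comp continuous_torusExp).measurable
  refine Finset.measurable_sum _ fun i _ => ?_
  have h1 : Measurable fun x : Fin n → UnitAddCircle => torusExp x i :=
    ((PiLp.continuous_apply 2 _ i).comp continuous_torusExp).measurable
  exact h1.mul ((((hc _).mul (hc _)).sub ((hc _).mul (hc _))).div ((hc _).pow_const 2))

theorem measurable_gradNorm {n : ℕ} (p q : MvPolynomial (Fin n) ℂ) :
    Measurable fun x : Fin n → UnitAddCircle => gradNorm p q (torusExp x) := by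
  have hc : ∀ r : MvPolynomial (Fin n) ℂ, Measurable fun x => pEval r (torusExp x) :=
    fun r => ((continuous_pEval r).comp continuous_torusExp).measurable
  refine Real.continuous_sqrt.measurable.comp (Finset.measurable_sum _ fun i _ => ?_)
  exact ((((hc _).mul (hc _)).sub ((hc _).mul (hc _))).div ((hc _).pow_const 2)).norm.pow_const 2

theorem measurable_fiberDensity {n : ℕ} (p q : MvPolynomial (Fin n) ℂ) :
    Measurable (fiberDensity p q) :=
  (measurable_radDeriv p q).norm.div ((measurable_gradNorm p q).const_mul _)

namespace IsRationalInner

variable {k : ℕ} {p q : MvPolynomial (Fin (k + 1)) ℂ} {φ : EuclideanSpace ℂ (Fin (k + 1)) → ℂ}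
  {α : ℂ}

theorem exists_partition_levelSet (h : IsRationalInner (k + 1) p q φ) (hα : ‖α‖ = 1) :
    ∃ E : ℕ → Set (Fin (k + 1) → UnitAddCircle), (∀ i, MeasurableSet (E i)) ∧
      Pairwise (Function.onFun Disjoint E) ∧ ⋃ i, E i = levelSet p q α ∧
        ∀ i, InjOn angleDiff (E i) :=
  exists_measurable_partition (measurableSet_levelSet p q α) (injOn_empty _)
    (fun _ _ hST hT => hT.mono hST) fun x hx => by
      obtain ⟨U, hU, hinj, -⟩ := h.exists_nhds_fiberMeasure hα hx one_lt_two
      exact ⟨U, hU, hinj⟩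

theorem fiberCount_apply {E : ℕ → Set (Fin (k + 1) → UnitAddCircle)}
    (hE : ∀ i, MeasurableSet (E i)) (hd : Pairwise (Function.onFun Disjoint E))
    (hV : ⋃ i, E i = levelSet p q α) (hinj : ∀ i, InjOn angleDiff (E i))
    {A : Set (Fin (k + 1) → UnitAddCircle)} (hA : MeasurableSet A) (w : Fin k → UnitAddCircle) :
    fiberCount p q α w A = ∑' i, (angleDiff '' (A ∩ E i)).indicator 1 w := by
  have hm : MeasurableSet (angleDiff (k := k) ⁻¹' {w}) :=
    continuous_angleDiff.measurable (measurableSet_singleton w)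
  have e : A ∩ (levelSet p q α ∩ angleDiff ⁻¹' {w}) =
      ⋃ i, (A ∩ E i) ∩ angleDiff ⁻¹' {w} := by
    rw [← iUnion_inter, ← inter_iUnion, hV, inter_assoc]
  rw [fiberCount, Measure.restrict_apply hA, e, measure_iUnion]
  · refine tsum_congr fun i => ?_
    by_cases hw : w ∈ angleDiff '' (A ∩ E i)
    · rw [indicator_of_mem hw]
      obtain ⟨x, hx, rfl⟩ := hw
      have : (A ∩ E i) ∩ angleDiff ⁻¹' {angleDiff x} = {x} := by
        ext y
        refine ⟨fun hy => hinj i hy.1.2 hx.2 hy.2, ?_⟩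
        rintro rfl
        exact ⟨hx, rfl⟩
      rw [this, Measure.count_singleton]
      rfl
    · rw [indicator_of_notMem hw]
      have : (A ∩ E i) ∩ angleDiff ⁻¹' {w} = ∅ :=
        eq_empty_of_forall_notMem fun y hy => hw ⟨y, hy.1, hy.2⟩
      rw [this, measure_empty]
  · exact fun i j hij => (hd hij).mono (inter_subset_left.trans inter_subset_right)
      (inter_subset_left.trans inter_subset_right)
  · exact fun i => (hA.inter (hE i)).inter hm

theorem measurable_fiberCount (h : IsRationalInner (k + 1) p q φ) (hα : ‖α‖ = 1) :
    Measurable (fiberCount p q α) := by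
  obtain ⟨E, hE, hd, hV, hinj⟩ := h.exists_partition_levelSet hα
  refine Measure.measurable_of_measurable_coe _ fun A hA => ?_
  simp only [fiberCount_apply hE hd hV hinj hA]
  exact Measurable.tsum fun i => measurable_one.indicator
    (measurableSet_image_angleDiff (hA.inter (hE i)) ((hinj i).mono inter_subset_right))

theorem fiberMeasure_eq_bind (h : IsRationalInner (k + 1) p q φ) (hα : ‖α‖ = 1) :
    fiberMeasure p q α = volume.bind (fiberCount p q α) := by
  obtain ⟨E, hE, hd, hV, hinj⟩ := h.exists_partition_levelSet hα
  ext A hA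
  have hm : ∀ i, MeasurableSet (angleDiff '' (A ∩ E i)) := fun i =>
    measurableSet_image_angleDiff (hA.inter (hE i)) ((hinj i).mono inter_subset_right)
  rw [Measure.bind_apply hA (h.measurable_fiberCount hα).aemeasurable]
  simp only [fiberCount_apply hE hd hV hinj hA]
  rw [lintegral_tsum fun i => (measurable_one.indicator (hm i)).aemeasurable]
  have e : fiberMeasure p q α A = fiberMeasure p q α (⋃ i, A ∩ E i) := by
    rw [← inter_iUnion, hV, fiberMeasure, withDensity_apply _ hA,
      withDensity_apply _ (hA.inter (measurableSet_levelSet p q α)),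
      Measure.restrict_restrict hA, Measure.restrict_restrict
        (hA.inter (measurableSet_levelSet p q α)), inter_assoc, inter_self]
  rw [e, measure_iUnion (fun i j hij => (hd hij).mono inter_subset_right inter_subset_right)
    fun i => hA.inter (hE i)]
  refine tsum_congr fun i => ?_
  rw [lintegral_indicator_one (hm i), h.fiberMeasure_eq_volume_image hα (hA.inter (hE i))
    (inter_subset_right.trans (hV ▸ subset_iUnion E i)) ((hinj i).mono inter_subset_right)]

theorem levelSet_inter_preimage (h : IsRationalInner (k + 1) p q φ) (hα : ‖α‖ = 1)
    {w : Fin k → UnitAddCircle} (hw : ∀ l, pEval q (torusExp (diagOrbit w l)) ≠ 0) :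
    levelSet p q α ∩ angleDiff ⁻¹' {w} = diagOrbit w '' (fiberRoots p q α w : Set UnitAddCircle) := by
  ext x
  constructor
  · rintro ⟨hx, rfl⟩
    refine ⟨x 0, ?_, diagOrbit_angleDiff x⟩
    rw [Finset.mem_coe, h.mem_fiberRoots hα, diagOrbit_angleDiff]
    exact hx.1
  · rintro ⟨l, hl, rfl⟩
    exact ⟨⟨(h.mem_fiberRoots hα).1 (Finset.mem_coe.1 hl), hw l⟩, angleDiff_diagOrbit w l⟩

theorem fiberCount_eq_sum_dirac (h : IsRationalInner (k + 1) p q φ) (hα : ‖α‖ = 1)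
    {w : Fin k → UnitAddCircle} (hw : ∀ l, pEval q (torusExp (diagOrbit w l)) ≠ 0) :
    fiberCount p q α w = ∑ l ∈ fiberRoots p q α w, Measure.dirac (diagOrbit w l) := by
  classical
  have hinj : Function.Injective (diagOrbit w) := fun l m hlm => by
    simpa [diagOrbit] using congrFun hlm 0
  ext A hA
  rw [fiberCount, h.levelSet_inter_preimage hα hw, Measure.restrict_apply hA,
    Measure.finsetSum_apply]
  have e : A ∩ diagOrbit w '' (fiberRoots p q α w : Set UnitAddCircle) =
      (((fiberRoots p q α w).filter fun l => diagOrbit w l ∈ A).image (diagOrbit w) :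
        Finset (Fin (k + 1) → UnitAddCircle)) := by
    ext x
    simp only [Finset.coe_image, Finset.coe_filter, mem_inter_iff, mem_image, Finset.mem_coe]
    constructor
    · rintro ⟨hx, l, hl, rfl⟩
      exact ⟨l, ⟨hl, hx⟩, rfl⟩
    · rintro ⟨l, ⟨hl, hx⟩, rfl⟩
      exact ⟨hx, l, hl, rfl⟩
  rw [e, Measure.count_apply_finset, Finset.card_image_of_injective _ hinj, Finset.card_filter,
    Nat.cast_sum]
  refine Finset.sum_congr rfl fun l _ => ?_
  rw [Measure.dirac_apply' _ hA]
  by_cases hl : diagOrbit w l ∈ A <;> simp [hl]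

theorem integral_fiberMeasure_withDensity (h : IsRationalInner (k + 1) p q φ) (hα : ‖α‖ = 1)
    [IsFiniteMeasure ((fiberMeasure p q α).withDensity
      fun x => ENNReal.ofReal ‖radDeriv p q (torusExp x)‖⁻¹)]
    (a : Fin (k + 1) → ℤ) :
    ∫ x, UnitAddTorus.mFourier a x ∂((fiberMeasure p q α).withDensity
      fun x => ENNReal.ofReal ‖radDeriv p q (torusExp x)‖⁻¹) =
    ∫ w : Fin k → UnitAddCircle, ∑ l ∈ fiberRoots p q α w,
      ((‖radDeriv p q (torusExp (diagOrbit w l))‖⁻¹ : ℝ) : ℂ) *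
        UnitAddTorus.mFourier a (diagOrbit w l) := by
  have hD : Measurable fun x => ENNReal.ofReal ‖radDeriv p q (torusExp x)‖⁻¹ :=
    (measurable_radDeriv p q).norm.inv.ennreal_ofReal
  have hfin : ∀ᵐ x ∂fiberMeasure p q α, ENNReal.ofReal ‖radDeriv p q (torusExp x)‖⁻¹ < ⊤ :=
    Eventually.of_forall fun _ => ENNReal.ofReal_lt_top
  let κ : ProbabilityTheory.Kernel (Fin k → UnitAddCircle) (Fin (k + 1) → UnitAddCircle) :=
    ⟨fiberCount p q α, h.measurable_fiberCount hα⟩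
  let κ₀ : ProbabilityTheory.Kernel Unit (Fin k → UnitAddCircle) :=
    ProbabilityTheory.Kernel.const Unit volume
  have hM : fiberMeasure p q α = (κ.comp κ₀) () := h.fiberMeasure_eq_bind hα
  have hint : Integrable (UnitAddTorus.mFourier a) ((fiberMeasure p q α).withDensity
      fun x => ENNReal.ofReal ‖radDeriv p q (torusExp x)‖⁻¹) :=
    (BoundedContinuousFunction.mkOfCompact (UnitAddTorus.mFourier a)).integrable _
  rw [integrable_withDensity_iff_integrable_smul₀' hD.aemeasurable hfin] at hint
  rw [integral_withDensity_eq_integral_toReal_smul₀ hD.aemeasurable hfin]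
  rw [hM] at hint ⊢
  rw [ProbabilityTheory.Kernel.integral_comp hint]
  refine integral_congr_ae ?_
  filter_upwards [h.ae_forall_eval_ne_zero] with w hw
  change ∫ y, _ ∂(fiberCount p q α w) = _
  rw [h.fiberCount_eq_sum_dirac hα hw, integral_finsetSum_measure]
  · refine Finset.sum_congr rfl fun l _ => ?_
    rw [integral_dirac, ENNReal.toReal_ofReal (by positivity), Complex.real_smul]
  · exact fun l _ => integrable_dirac enorm_lt_top

theorem fiberMeasure_withDensity_univ (h : IsRationalInner (k + 1) p q φ) (hα : ‖α‖ = 1) :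
    (fiberMeasure p q α).withDensity
      (fun x => ENNReal.ofReal ‖radDeriv p q (torusExp x)‖⁻¹) univ =
      ENNReal.ofReal ((1 - ‖φ 0‖ ^ 2) / ‖α - φ 0‖ ^ 2) := by
  have hD : Measurable fun x => ENNReal.ofReal ‖radDeriv p q (torusExp x)‖⁻¹ :=
    (measurable_radDeriv p q).norm.inv.ennreal_ofReal
  rw [withDensity_apply _ MeasurableSet.univ, Measure.restrict_univ, h.fiberMeasure_eq_bind hα,
    Measure.lintegral_bind (h.measurable_fiberCount hα).aemeasurable hD.aemeasurable]
  calc _ = ∫⁻ _ : Fin k → UnitAddCircle, ENNReal.ofReal ((1 - ‖φ 0‖ ^ 2) / ‖α - φ 0‖ ^ 2) := by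
        refine lintegral_congr_ae ?_
        filter_upwards [h.ae_forall_eval_ne_zero] with w hw
        rw [h.fiberCount_eq_sum_dirac hα hw, lintegral_finsetSum_measure,
          ← h.sum_fiberRoots hα hw, ENNReal.ofReal_sum_of_nonneg fun _ _ => by positivity]
        exact Finset.sum_congr rfl fun l _ => lintegral_dirac' _ hD
    _ = _ := by rw [lintegral_const, volume_pi, Measure.pi_univ]; simp

theorem eq_withDensity_torusHausdorff (h : IsRationalInner (k + 1) p q φ) (hα : ‖α‖ = 1)
    (μ : Measure (Fin (k + 1) → UnitAddCircle)) [IsFiniteMeasure μ]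
    (hμ : ∀ r : ℝ, 0 ≤ r → r < 1 → ∀ x, ∫ y, ∏ j, circlePoisson r (x j) (y j) ∂μ =
      (1 - ‖φ ((r : ℂ) • torusExp x)‖ ^ 2) / ‖α - φ ((r : ℂ) • torusExp x)‖ ^ 2) :
    μ = ((torusHausdorff k).restrict (levelSet p q α)).withDensity
      fun x => ENNReal.ofReal (((2 * Real.pi) ^ k)⁻¹ * (gradNorm p q (torusExp x))⁻¹) := by
  have hD : Measurable fun x => ENNReal.ofReal ‖radDeriv p q (torusExp x)‖⁻¹ :=
    (measurable_radDeriv p q).norm.inv.ennreal_ofReal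
  have hfin : IsFiniteMeasure ((fiberMeasure p q α).withDensity
      fun x => ENNReal.ofReal ‖radDeriv p q (torusExp x)‖⁻¹) :=
    ⟨by rw [h.fiberMeasure_withDensity_univ hα]; exact ENNReal.ofReal_lt_top⟩
  have e : μ = (fiberMeasure p q α).withDensity
      fun x => ENNReal.ofReal ‖radDeriv p q (torusExp x)‖⁻¹ :=
    ext_of_integral_mFourier_eq fun a => by
      rw [h.integral_fiberMeasure_withDensity hα, h.integral_mFourier_eq hα μ hμ]
  rw [e, fiberMeasure, ← withDensity_mul _ (measurable_fiberDensity p q).ennreal_ofReal hD]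
  refine withDensity_congr_ae ?_
  filter_upwards [ae_restrict_mem (measurableSet_levelSet p q α)] with x hx
  have h1 := (h.radDeriv_eq (torusExp_mem x) hx.2).1
  have h2 := h.gradNorm_pos (torusExp_mem x) hx.2
  have := Real.pi_pos
  rw [Pi.mul_apply, ← ENNReal.ofReal_mul (h.fiberDensity_pos hx).le, fiberDensity,
    Nat.add_sub_cancel]
  congr 1
  field_simp

end IsRationalInner

theorem gradNorm_eq_zero {n : ℕ} {p q : MvPolynomial (Fin n) ℂ} {ζ : EuclideanSpace ℂ (Fin n)}
    (hq : pEval q ζ = 0) : gradNorm p q ζ = 0 := by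
  simp [gradNorm, hq]

/-- The zero set of the denominator does not contribute to integrals of `|∇φ|⁻¹`. -/
theorem setLIntegral_inv_gradNorm {n : ℕ} (p q : MvPolynomial (Fin n) ℂ)
    (ν : Measure (EuclideanSpace ℂ (Fin n))) (S : Set (EuclideanSpace ℂ (Fin n))) :
    ∫⁻ ζ in S, ENNReal.ofReal (gradNorm p q ζ)⁻¹ ∂ν =
      ∫⁻ ζ in S ∩ {ζ | pEval q ζ ≠ 0}, ENNReal.ofReal (gradNorm p q ζ)⁻¹ ∂ν := by
  have hm : MeasurableSet {ζ : EuclideanSpace ℂ (Fin n) | pEval q ζ ≠ 0} :=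
    (isClosed_eq (continuous_pEval q) continuous_const).isOpen_compl.measurableSet
  rw [← lintegral_inter_add_sdiff _ S hm]
  refine (congrArg _ (nonpos_iff_eq_zero.1 ?_)).trans (add_zero _)
  calc _ ≤ ∫⁻ ζ in {ζ | pEval q ζ ≠ 0}ᶜ, ENNReal.ofReal (gradNorm p q ζ)⁻¹ ∂ν :=
        lintegral_mono_set fun x hx => hx.2
    _ = ∫⁻ ζ in {ζ | pEval q ζ ≠ 0}ᶜ, 0 ∂ν :=
        setLIntegral_congr_fun hm.compl fun ζ hζ => by
          simp [gradNorm_eq_zero (p := p) (not_not.1 hζ)]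
    _ = 0 := lintegral_zero
    _ ≤ 0 := le_rfl

theorem IsClarkMeasure.apply_eq {k : ℕ} {p q : MvPolynomial (Fin (k + 1)) ℂ}
    {φ : EuclideanSpace ℂ (Fin (k + 1)) → ℂ} (hφ : IsRationalInner (k + 1) p q φ)
    {α : ℂ} (hα : ‖α‖ = 1) {μ : Measure (EuclideanSpace ℂ (Fin (k + 1)))}
    (hμ : IsClarkMeasure (k + 1) φ α μ) {A : Set (EuclideanSpace ℂ (Fin (k + 1)))}
    (hA : MeasurableSet A) :
    μ A = ENNReal.ofReal ((2 * Real.pi) ^ k)⁻¹ *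
      ∫⁻ ζ in A ∩ {ζ | ζ ∈ torus (Fin (k + 1)) ∧ pEval p ζ = α * pEval q ζ} ∩
        {ζ | pEval q ζ ≠ 0}, ENNReal.ofReal (gradNorm p q ζ)⁻¹
          ∂((cubeMeasure k)⁻¹ • μH[(k : ℝ)]) := by
  have hfin := hμ.isFiniteMeasure_comap
  have hemb := measurableEmbedding_torusExp (ι := Fin (k + 1))
  have hpi := Real.pi_pos
  have key := hφ.eq_withDensity_torusHausdorff hα (μ.comap torusExp)
    fun r hr0 hr x => hμ.integral_circlePoisson hφ.abs_lt_one hr0 hr x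
  set S : Set (EuclideanSpace ℂ (Fin (k + 1))) :=
    A ∩ {ζ | pEval p ζ = α * pEval q ζ ∧ pEval q ζ ≠ 0} with hS
  have hSm : MeasurableSet S :=
    hA.inter ((isClosed_eq (continuous_pEval p)
      (continuous_const.mul (continuous_pEval q))).measurableSet.inter
        (isClosed_eq (continuous_pEval q) continuous_const).isOpen_compl.measurableSet)
  have hS' : A ∩ {ζ | ζ ∈ torus (Fin (k + 1)) ∧ pEval p ζ = α * pEval q ζ} ∩
      {ζ | pEval q ζ ≠ 0} = S ∩ torus (Fin (k + 1)) := by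
    ext ζ
    simp only [hS, mem_inter_iff, mem_ofPred_eq]
    tauto
  have hpre : torusExp ⁻¹' A ∩ levelSet p q α = torusExp ⁻¹' S := rfl
  have hfun : Measurable fun ζ : EuclideanSpace ℂ (Fin (k + 1)) =>
      ENNReal.ofReal (gradNorm p q ζ)⁻¹ := by
    have hc : ∀ r : MvPolynomial (Fin (k + 1)) ℂ, Measurable (pEval r) :=
      fun r => (continuous_pEval r).measurable
    refine (Real.continuous_sqrt.measurable.comp
      (Finset.measurable_sum _ fun i _ => ?_)).inv.ennreal_ofReal
    exact ((((hc _).mul (hc _)).sub ((hc _).mul (hc _))).div ((hc _).pow_const 2)).norm.pow_const 2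
  have hAm := hemb.measurable hA
  conv_lhs => rw [← hμ.map_comap_torusExp]
  rw [hemb.map_apply, key, withDensity_apply _ hAm, Measure.restrict_restrict hAm, hpre, hS']
  simp only [ENNReal.ofReal_mul (inv_nonneg.2 (pow_nonneg (by positivity : 0 ≤ 2 * Real.pi) k))]
  refine (lintegral_const_mul _ (hfun.comp hemb.measurable)).trans (congrArg _ ?_)
  simp only [Function.comp_def]
  rw [← hemb.lintegral_map (μ := (torusHausdorff k).restrict (torusExp ⁻¹' S))
    (fun ζ => ENNReal.ofReal (gradNorm p q ζ)⁻¹), ← hemb.restrict_map, torusHausdorff,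
    Measure.map_smul, hemb.map_comap, range_torusExp, ← Measure.restrict_smul,
    Measure.restrict_restrict hSm]

/-- Explicit description of the Clark measures of a rational inner function on the polydisc:
`μ_α = (2π)^{1-n} |∇φ|⁻¹ χ_{V_α} · ℋ^{n-1} = (2π)^{1-n} |∇φ|⁻¹ χ_{φ₁⁻¹(α)} · ℋ^{n-1}`,
where `ℋ^{n-1}` is normalized so that `(n-1)`-dimensional unit cubes have measure `1`. -/
theorem clark_measure_eq_hausdorff {n : ℕ} (p q : MvPolynomial (Fin n) ℂ)
    (φ : EuclideanSpace ℂ (Fin n) → ℂ) (hφ : IsRationalInner n p q φ)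
    (α : ℂ) (hα : ‖α‖ = 1)
    (μ : Measure (EuclideanSpace ℂ (Fin n))) (hμ : IsClarkMeasure n φ α μ)
    (Vα : Set (EuclideanSpace ℂ (Fin n)))
    (hVα : Vα = {ζ | ζ ∈ torus (Fin n) ∧ pEval p ζ = α * pEval q ζ}) :
    ∀ A : Set (EuclideanSpace ℂ (Fin n)), MeasurableSet A →
      μ A = ENNReal.ofReal ((2 * Real.pi) ^ (1 - (n : ℤ))) *
          ∫⁻ ζ in A ∩ Vα, ENNReal.ofReal (gradNorm p q ζ)⁻¹
            ∂((cubeMeasure (n - 1))⁻¹ • μH[(n : ℝ) - 1]) ∧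
      μ A = ENNReal.ofReal ((2 * Real.pi) ^ (1 - (n : ℤ))) *
          ∫⁻ ζ in A ∩ radialFiber φ α, ENNReal.ofReal (gradNorm p q ζ)⁻¹
            ∂((cubeMeasure (n - 1))⁻¹ • μH[(n : ℝ) - 1]) := by
  intro A hA
  obtain ⟨k, rfl⟩ : ∃ k, n = k + 1 := Nat.exists_eq_succ_of_ne_zero hφ.dim_ne_zero
  have e1 : (1 : ℤ) - ((k + 1 : ℕ) : ℤ) = -(k : ℤ) := by push_cast; ring
  have e2 : ((k + 1 : ℕ) : ℝ) - 1 = (k : ℝ) := by push_cast; ring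
  have e3 : A ∩ radialFiber φ α ∩ {ζ | pEval q ζ ≠ 0} =
      A ∩ {ζ | ζ ∈ torus (Fin (k + 1)) ∧ pEval p ζ = α * pEval q ζ} ∩ {ζ | pEval q ζ ≠ 0} := by
    ext ζ
    constructor
    · rintro ⟨⟨h1, h2⟩, h3⟩
      exact ⟨⟨h1, h2.1, (hφ.mem_radialFiber_iff h2.1 h3).1 h2⟩, h3⟩
    · rintro ⟨⟨h1, h2⟩, h3⟩
      exact ⟨⟨h1, (hφ.mem_radialFiber_iff h2.1 h3).2 h2.2⟩, h3⟩
  have key := hμ.apply_eq hφ hα hA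
  rw [e1, e2, Nat.add_sub_cancel, zpow_neg, zpow_natCast, hVα,
    setLIntegral_inv_gradNorm p q _ (A ∩ radialFiber φ α), e3,
    setLIntegral_inv_gradNorm p q _
      (A ∩ {ζ | ζ ∈ torus (Fin (k + 1)) ∧ pEval p ζ = α * pEval q ζ})]
  exact ⟨key, key⟩

end
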